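/- For every fixed n ≥ 2 there exists a constant ε > 0 such that for every prime power q with (n,q) ∉ {(2,2),(2,3)} the following holds for G = PSL_n(𝔽_q): if A is a normal subset of G containing at least one nonidentity element, then either |A²| ≥ |A|^{1+ε} or every nonidentity element of G lies in A². -/

import Mathlib

open scoped Pointwise

open ComplexConjugate in
theorem sum_norm_sq_sum_of_orthogonal {ι X : Type*} [Fintype X] (s : Finset ι) (u : ι → X → ℂ)
    (h : ∀ i ∈ s, ∀ j ∈ s, i ≠ j → ∑ y, u i y * conj (u j y) = 0) :
    ∑ y, ‖∑ i ∈ s, u i y‖ ^ 2 = ∑ i ∈ s, ∑ y, ‖u i y‖ ^ 2 := by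
  have key : ((∑ y, ‖∑ i ∈ s, u i y‖ ^ 2 : ℝ) : ℂ) = ((∑ i ∈ s, ∑ y, ‖u i y‖ ^ 2 : ℝ) : ℂ) := by
    push_cast
    simp only [← Complex.mul_conj', map_sum, Finset.sum_mul_sum]
    rw [Finset.sum_comm]
    refine Finset.sum_congr rfl fun i hi => ?_
    rw [Finset.sum_comm, Finset.sum_eq_single i]
    · intro j hj hij
      exact h i hi j hj (Ne.symm hij)
    · exact fun h => absurd hi h
  exact_mod_cast key

open ComplexConjugate in
theorem sum_norm_sq_le_of_orthogonal {ι X : Type*} [Fintype X] (s : Finset ι) (u : ι → X → ℂ)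
    (h : ∀ i ∈ s, ∀ j ∈ s, i ≠ j → ∑ y, u i y * conj (u j y) = 0)
    (c : ℝ) (hc0 : 0 ≤ c) (hc : ∀ i ∈ s, ∑ y, ‖u i y‖ ^ 2 = c) (a : X → ℂ) :
    ∑ i ∈ s, ‖∑ y, a y * u i y‖ ^ 2 ≤ (∑ y, ‖a y‖ ^ 2) * c := by
  set b : ι → ℂ := fun i => ∑ y, a y * u i y with hb
  set t : ℝ := ∑ i ∈ s, ‖b i‖ ^ 2 with ht
  have h1 : ∑ y, ‖∑ i ∈ s, conj (b i) * u i y‖ ^ 2 = t * c := by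
    rw [sum_norm_sq_sum_of_orthogonal s (fun i y => conj (b i) * u i y), ht, Finset.sum_mul]
    · refine Finset.sum_congr rfl fun i hi => ?_
      simp only [norm_mul, RCLike.norm_conj, mul_pow, ← Finset.mul_sum, hc i hi]
    · intro i hi j hj hij
      have : ∀ y, conj (b i) * u i y * conj (conj (b j) * u j y)
          = (conj (b i) * b j) * (u i y * conj (u j y)) := by
        intro y; simp only [map_mul, Complex.conj_conj]; ring
      simp only [this, ← Finset.mul_sum, h i hi j hj hij, mul_zero]
  have h2 : (t : ℂ) = ∑ y, a y * ∑ i ∈ s, conj (b i) * u i y := by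
    simp only [ht, Finset.mul_sum]
    rw [Finset.sum_comm]
    push_cast
    refine Finset.sum_congr rfl fun i _ => ?_
    rw [← Complex.mul_conj', mul_comm, hb, Finset.mul_sum]
    exact Finset.sum_congr rfl fun y _ => by ring
  have h3 : t ≤ ∑ y, ‖a y‖ * ‖∑ i ∈ s, conj (b i) * u i y‖ := by
    have : t ≤ ‖(t : ℂ)‖ := by rw [Complex.norm_real]; exact le_abs_self t
    rw [h2] at this
    refine this.trans ((norm_sum_le _ _).trans_eq ?_)
    simp only [norm_mul]
  have h4 := Finset.sum_mul_sq_le_sq_mul_sq Finset.univ (fun y => ‖a y‖)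
    (fun y => ‖∑ i ∈ s, conj (b i) * u i y‖)
  rw [h1] at h4
  have ht0 : 0 ≤ t := Finset.sum_nonneg fun _ _ => by positivity
  rcases ht0.eq_or_lt with h0 | h0
  · rw [← h0]
    positivity
  · have h5 : t ^ 2 ≤ (∑ y, ‖a y‖ ^ 2) * (t * c) :=
      (pow_le_pow_left₀ ht0 h3 2).trans h4
    nlinarith

open ComplexConjugate in
theorem sum_mul_conj_eq_zero_of_scaling {X : Type*} [Fintype X] (e : Equiv.Perm X) (u v : X → ℂ)
    (a b : ℂ) (ha : ∀ x, u (e x) = a * u x) (hb : ∀ x, v (e x) = b * v x)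
    (hb1 : ‖b‖ = 1) (hab : a ≠ b) : ∑ x, u x * conj (v x) = 0 := by
  have h1 : ∑ x, u x * conj (v x) = (a * conj b) * ∑ x, u x * conj (v x) := by
    conv_lhs => rw [← Equiv.sum_comp e]
    rw [Finset.mul_sum]
    refine Finset.sum_congr rfl fun x _ => ?_
    rw [ha, hb, map_mul]; ring
  have h2 : a * conj b ≠ 1 := by
    intro h
    apply hab
    have : conj b * b = 1 := by
      rw [mul_comm, Complex.mul_conj', hb1]; simp
    calc a = a * (conj b * b) := by rw [this, mul_one]
      _ = (a * conj b) * b := by ring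
      _ = b := by rw [h, one_mul]
  have h3 : (1 - a * conj b) * ∑ x, u x * conj (v x) = 0 := by
    rw [sub_mul, one_mul, ← h1, sub_self]
  exact (mul_eq_zero.mp h3).resolve_left (sub_ne_zero.mpr (Ne.symm h2))

open ComplexConjugate in
/-- Convolution by a class function `f` is a Hilbert-Schmidt operator commuting with both
translations; a component transforming by a nontrivial character of an abelian subgroup on both
sides occurs with many mutually orthogonal translates. -/
theorem convolution_component_bound {G V L : Type*} [Group G] [Fintype G] [AddCommGroup V]
    [Fintype V] (ι : V → G) (χ : L → AddChar V ℂ)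
    (hinj : Function.Injective χ) (ℓ : L) (O : Finset L)
    (hO : ∀ ℓ' ∈ O, ∃ (s : G) (a : V → V), ∀ v, s⁻¹ * ι v * s = ι (a v) ∧ χ ℓ (a v) = χ ℓ' v)
    (f H : G → ℂ) (hf : ∀ g x, f (g * x * g⁻¹) = f x)
    (hl : ∀ v x, H (ι v * x) = χ ℓ v * H x) (hr : ∀ v x, H (x * ι v) = χ ℓ v * H x) :
    (∑ x, ‖∑ y, f (x * y⁻¹) * H y‖ ^ 2) * (O.card : ℝ) ^ 2 ≤
      Fintype.card G * (∑ x, ‖f x‖ ^ 2) * ∑ x, ‖H x‖ ^ 2 := by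
  choose! s a hs using hO
  set U : L × L → G → ℂ := fun p x => H ((s p.1)⁻¹ * x * s p.2) with hU
  have trans_sum : ∀ (p : L × L) (φ : G → ℝ), ∑ x, φ ((s p.1)⁻¹ * x * s p.2) = ∑ x, φ x := by
    intro p φ
    exact Equiv.sum_comp ((Equiv.mulLeft (s p.1)⁻¹).trans (Equiv.mulRight (s p.2))) φ
  have hUl : ∀ p ∈ O ×ˢ O, ∀ v x, U p (ι v * x) = χ p.1 v * U p x := by
    intro p hp v x
    rw [Finset.mem_product] at hp
    have h := hs p.1 hp.1 v
    simp only [hU]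
    rw [show (s p.1)⁻¹ * (ι v * x) * s p.2
      = ((s p.1)⁻¹ * ι v * s p.1) * ((s p.1)⁻¹ * x * s p.2) by group, h.1, hl, h.2]
  have hUr : ∀ p ∈ O ×ˢ O, ∀ v x, U p (x * ι v) = χ p.2 v * U p x := by
    intro p hp v x
    rw [Finset.mem_product] at hp
    have h := hs p.2 hp.2 v
    simp only [hU]
    rw [show (s p.1)⁻¹ * (x * ι v) * s p.2
      = ((s p.1)⁻¹ * x * s p.2) * ((s p.2)⁻¹ * ι v * s p.2) by group, h.1, hr, h.2]
  have horth : ∀ p ∈ O ×ˢ O, ∀ r ∈ O ×ˢ O, p ≠ r → ∑ y, U p y * conj (U r y) = 0 := by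
    intro p hp r hr hpr
    by_cases h1 : p.1 = r.1
    · have h2 : p.2 ≠ r.2 := fun h => hpr (Prod.ext h1 h)
      obtain ⟨v, hv⟩ := DFunLike.ne_iff.mp (hinj.ne h2)
      exact sum_mul_conj_eq_zero_of_scaling (Equiv.mulRight (ι v)) _ _ _ _
        (hUr p hp v) (hUr r hr v) (AddChar.norm_apply _ _) hv
    · obtain ⟨v, hv⟩ := DFunLike.ne_iff.mp (hinj.ne h1)
      exact sum_mul_conj_eq_zero_of_scaling (Equiv.mulLeft (ι v)) _ _ _ _
        (hUl p hp v) (hUl r hr v) (AddChar.norm_apply _ _) hv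
  have hnorm : ∀ p ∈ O ×ˢ O, ∑ y, ‖U p y‖ ^ 2 = ∑ x, ‖H x‖ ^ 2 := fun p _ =>
    trans_sum p (fun x => ‖H x‖ ^ 2)
  have hrow : ∀ x, ∑ p ∈ O ×ˢ O, ‖∑ y, f (x * y⁻¹) * U p y‖ ^ 2 ≤
      (∑ y, ‖f y‖ ^ 2) * ∑ x, ‖H x‖ ^ 2 := by
    intro x
    refine (sum_norm_sq_le_of_orthogonal (O ×ˢ O) U horth _ (by positivity) hnorm
      (fun y => f (x * y⁻¹))).trans_eq ?_
    congr 1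
    exact Equiv.sum_comp ((Equiv.inv G).trans (Equiv.mulLeft x)) (fun y => ‖f y‖ ^ 2)
  have hcol : ∀ p ∈ O ×ˢ O, ∑ x, ‖∑ y, f (x * y⁻¹) * U p y‖ ^ 2 =
      ∑ x, ‖∑ y, f (x * y⁻¹) * H y‖ ^ 2 := by
    intro p _
    rw [← trans_sum p (fun x => ‖∑ y, f (x * y⁻¹) * H y‖ ^ 2)]
    refine Finset.sum_congr rfl fun x _ => ?_
    congr 2
    rw [← Equiv.sum_comp ((Equiv.mulLeft (s p.1)⁻¹).trans (Equiv.mulRight (s p.2)))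
      (fun y => f ((s p.1)⁻¹ * x * s p.2 * y⁻¹) * H y)]
    refine Finset.sum_congr rfl fun y _ => ?_
    simp only [hU, Equiv.trans_apply, Equiv.coe_mulLeft, Equiv.coe_mulRight]
    congr 1
    rw [← hf (s p.1)⁻¹ (x * y⁻¹)]
    congr 1
    group
  have hsum := Finset.sum_le_sum fun x (_ : x ∈ (Finset.univ : Finset G)) => hrow x
  rw [Finset.sum_comm, Finset.sum_congr rfl hcol, Finset.sum_const, Finset.sum_const,
    Finset.card_product, nsmul_eq_mul, nsmul_eq_mul, Finset.card_univ] at hsum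
  push_cast at hsum
  nlinarith [hsum]

open ComplexConjugate in
theorem convolution_sub_average_bound {G V L : Type*} [Group G] [Fintype G] [AddCommGroup V]
    [Fintype V] [Fintype L] [DecidableEq V] (ι : V → G) (hι : ∀ v w, ι (v + w) = ι v * ι w)
    (χ : L → AddChar V ℂ)
    (hinj : Function.Injective χ) (ℓ₀ : L) (hℓ₀ : ∀ v, χ ℓ₀ v = 1)
    (hsum : ∀ v, ∑ ℓ, χ ℓ v = if v = 0 then (Fintype.card V : ℂ) else 0)
    (d : ℕ) (hd : ∀ ℓ, ℓ ≠ ℓ₀ → ∃ O : Finset L, d ≤ O.card ∧ ∀ ℓ' ∈ O, ∃ (s : G) (a : V → V),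
      ∀ v, s⁻¹ * ι v * s = ι (a v) ∧ χ ℓ (a v) = χ ℓ' v)
    (f F Ψ : G → ℂ) (hf : ∀ g x, f (g * x * g⁻¹) = f x) (hF : ∀ g x, F (g * x * g⁻¹) = F x)
    (hΨ : ∀ x, Ψ x = ∑ y, f (x * y⁻¹) * F y) :
    (∑ x, ‖Ψ x - (Fintype.card V : ℂ)⁻¹ * ∑ v, Ψ (ι v * x)‖ ^ 2) * (d : ℝ) ^ 2 ≤
      Fintype.card G * (∑ x, ‖f x‖ ^ 2) * ∑ x, ‖F x‖ ^ 2 := by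
  classical
  have hV : (Fintype.card V : ℂ) ≠ 0 := Nat.cast_ne_zero.mpr Fintype.card_ne_zero
  have hι0 : ι 0 = 1 := by
    have := hι 0 0
    rwa [add_zero, left_eq_mul] at this
  set C : L → G → ℂ := fun ℓ x => (Fintype.card V : ℂ)⁻¹ * ∑ v, conj (χ ℓ v) * F (ι v * x) with hC
  have hunit : ∀ ℓ v, χ ℓ v * conj (χ ℓ v) = 1 := by
    intro ℓ v
    rw [Complex.mul_conj', AddChar.norm_apply]; simp
  have hCl : ∀ ℓ w x, C ℓ (ι w * x) = χ ℓ w * C ℓ x := by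
    intro ℓ w x
    simp only [hC]
    rw [← Equiv.sum_comp (Equiv.addRight w) (fun v => conj (χ ℓ v) * F (ι v * x)),
      mul_left_comm]
    congr 1
    rw [Finset.mul_sum]
    refine Finset.sum_congr rfl fun v _ => ?_
    rw [Equiv.coe_addRight, AddChar.map_add_eq_mul, map_mul, hι, ← mul_assoc (ι v)]
    linear_combination (conj (χ ℓ v) * F (ι v * ι w * x)) * (-(hunit ℓ w))
  have hCr : ∀ ℓ w x, C ℓ (x * ι w) = χ ℓ w * C ℓ x := by
    intro ℓ w x
    rw [← hCl]
    simp only [hC]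
    congr 1
    refine Finset.sum_congr rfl fun v _ => ?_
    congr 1
    rw [← hF (ι w) (ι v * (x * ι w))]
    congr 1
    have : ι w * ι v = ι v * ι w := by rw [← hι, ← hι, add_comm]
    rw [← mul_assoc (ι w), this]
    group
  have hCsum : ∀ x, ∑ ℓ, C ℓ x = F x := by
    intro x
    simp only [hC]
    rw [← Finset.mul_sum, Finset.sum_comm]
    have : ∀ v, ∑ ℓ, conj (χ ℓ v) * F (ι v * x)
        = if v = 0 then (Fintype.card V : ℂ) * F x else 0 := by
      intro v
      rw [← Finset.sum_mul, ← map_sum, hsum]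
      split_ifs with h
      · rw [h, hι0, one_mul, Complex.conj_natCast]
      · simp
    simp only [this, Finset.sum_ite_eq', Finset.mem_univ, if_true]
    field_simp
  set K : (G → ℂ) → G → ℂ := fun H x => ∑ y, f (x * y⁻¹) * H y with hK
  have hKl : ∀ ℓ v x, K (C ℓ) (ι v * x) = χ ℓ v * K (C ℓ) x := by
    intro ℓ v x
    simp only [hK]
    rw [← Equiv.sum_comp (Equiv.mulLeft (ι v)) (fun y => f (ι v * x * y⁻¹) * C ℓ y),
      Finset.mul_sum]
    refine Finset.sum_congr rfl fun y _ => ?_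
    rw [Equiv.coe_mulLeft, hCl, ← hf (ι v) (x * y⁻¹),
      show ι v * x * (ι v * y)⁻¹ = ι v * (x * y⁻¹) * (ι v)⁻¹ by group]
    ring
  have hΨsum : ∀ x, Ψ x = ∑ ℓ, K (C ℓ) x := by
    intro x
    rw [hΨ, hK]
    simp only
    rw [Finset.sum_comm]
    refine Finset.sum_congr rfl fun y _ => ?_
    rw [← Finset.mul_sum, hCsum]
  have havg : ∀ x, (Fintype.card V : ℂ)⁻¹ * ∑ v, Ψ (ι v * x) = K (C ℓ₀) x := by
    intro x
    have h1 : ∀ v, Ψ (ι v * x) = ∑ ℓ, χ ℓ v * K (C ℓ) x := fun v => by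
      rw [hΨsum]; exact Finset.sum_congr rfl fun ℓ _ => hKl ℓ v x
    simp only [h1]
    rw [Finset.sum_comm, Finset.sum_eq_single ℓ₀]
    · simp only [hℓ₀, one_mul, Finset.sum_const, Finset.card_univ, nsmul_eq_mul]
      field_simp
    · intro ℓ _ hℓ
      have hne : χ ℓ ≠ 0 := by
        intro h
        apply hℓ
        apply hinj
        rw [h]
        ext v
        rw [hℓ₀, AddChar.zero_apply]
      rw [← Finset.sum_mul, AddChar.sum_eq_zero_of_ne_one (by rwa [AddChar.one_eq_zero]), zero_mul]
    · simp
  have hdiff : ∀ x, Ψ x - (Fintype.card V : ℂ)⁻¹ * ∑ v, Ψ (ι v * x) =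
      ∑ ℓ ∈ Finset.univ.erase ℓ₀, K (C ℓ) x := by
    intro x
    rw [havg, hΨsum, ← Finset.sum_erase_add _ _ (Finset.mem_univ ℓ₀), add_sub_cancel_right]
  have horthK : ∀ i, ∀ j, i ≠ j → ∑ y, K (C i) y * conj (K (C j) y) = 0 := by
    intro i j hij
    obtain ⟨v, hv⟩ := DFunLike.ne_iff.mp (hinj.ne hij)
    exact sum_mul_conj_eq_zero_of_scaling (Equiv.mulLeft (ι v)) _ _ _ _
        (hKl i v) (hKl j v) (AddChar.norm_apply _ _) hv
  have horthC : ∀ i, ∀ j, i ≠ j → ∑ y, C i y * conj (C j y) = 0 := by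
    intro i j hij
    obtain ⟨v, hv⟩ := DFunLike.ne_iff.mp (hinj.ne hij)
    exact sum_mul_conj_eq_zero_of_scaling (Equiv.mulLeft (ι v)) _ _ _ _
        (hCl i v) (hCl j v) (AddChar.norm_apply _ _) hv
  have hFnorm : ∑ x, ‖F x‖ ^ 2 = ∑ ℓ, ∑ x, ‖C ℓ x‖ ^ 2 := by
    rw [← sum_norm_sq_sum_of_orthogonal _ _ (fun i _ j _ => horthC i j)]
    simp only [hCsum]
  simp only [hdiff]
  rw [sum_norm_sq_sum_of_orthogonal _ _ (fun i _ j _ => horthK i j), hFnorm, Finset.sum_mul,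
    Finset.mul_sum]
  refine (Finset.sum_le_sum fun ℓ hℓ => ?_).trans (Finset.sum_le_sum_of_subset_of_nonneg
    (Finset.subset_univ (Finset.univ.erase ℓ₀)) fun _ _ _ => by positivity)
  obtain ⟨O, hdO, hO⟩ := hd ℓ (Finset.ne_of_mem_erase hℓ)
  refine le_trans ?_ (convolution_component_bound ι χ hinj ℓ O hO f (C ℓ) hf (hCl ℓ) (hCr ℓ))
  gcongr

theorem sum_sq_card_conj_eq {G : Type*} [Group G] [Fintype G] [DecidableEq G] (g : G) :
    ∑ z, ((Finset.univ.filter fun h : G => h * g * h⁻¹ = z).card : ℝ) ^ 2 =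
      Fintype.card G * ((Finset.univ.filter fun h : G => h * g = g * h).card : ℝ) := by
  have h1 : ∀ h : G, ∑ z, (if h * g * h⁻¹ = z then (1 : ℝ) else 0) *
      ((Finset.univ.filter fun h : G => h * g * h⁻¹ = z).card : ℝ) =
        ((Finset.univ.filter fun h : G => h * g = g * h).card : ℝ) := by
    intro h
    simp only [ite_mul, one_mul, zero_mul, Finset.sum_ite_eq, Finset.mem_univ, if_true]
    congr 1
    refine Finset.card_bij (fun k _ => h⁻¹ * k) ?_ ?_ ?_
    · intro k hk
      simp only [Finset.mem_filter, Finset.mem_univ, true_and] at hk ⊢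
      have : k * g = h * g * h⁻¹ * k := by rw [← hk]; group
      rw [mul_assoc, this]; group
    · intro a _ b _ hab
      exact mul_left_cancel hab
    · intro b hb
      simp only [Finset.mem_filter, Finset.mem_univ, true_and] at hb
      refine ⟨h * b, ?_, by group⟩
      simp only [Finset.mem_filter, Finset.mem_univ, true_and]
      rw [mul_assoc h b g, hb]; group
  have h2 : ∀ z, ((Finset.univ.filter fun h : G => h * g * h⁻¹ = z).card : ℝ) ^ 2 =
      ∑ h : G, (if h * g * h⁻¹ = z then (1 : ℝ) else 0) *
      ((Finset.univ.filter fun h : G => h * g * h⁻¹ = z).card : ℝ) := by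
    intro z
    rw [← Finset.sum_mul, sq]
    congr 1
    simp
  simp only [h2]
  rw [Finset.sum_comm]
  simp only [h1, Finset.sum_const, Finset.card_univ, nsmul_eq_mul]

theorem sum_sq_le_of_bounded_generation {G : Type*} [Group G] [Fintype G] (T : Set G) (K : ℕ)
    (hgen : ∀ g : G, ∃ l : List G, l.length ≤ K ∧ (∀ t ∈ l, t ∈ T) ∧ l.prod = g)
    (Ψ : G → ℝ) (hΨ : ∑ x, Ψ x = 0) (E : ℝ) (hE : 0 ≤ E)
    (hT : ∀ t ∈ T, ∑ x, (Ψ (t * x) - Ψ x) ^ 2 ≤ E) :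
    ∑ x, Ψ x ^ 2 ≤ 2 ^ K * E := by
  have h1 : ∀ l : List G, (∀ t ∈ l, t ∈ T) →
      ∑ x, (Ψ (l.prod * x) - Ψ x) ^ 2 ≤ 2 * (2 ^ l.length - 1) * E := by
    intro l
    induction l with
    | nil => intro _; simp
    | cons t l ih =>
      intro hl
      have ih' := ih fun t ht => hl t (List.mem_cons_of_mem _ ht)
      have ht := hT t (hl t List.mem_cons_self)
      have h3 : ∑ x, (Ψ (t * (l.prod * x)) - Ψ (l.prod * x)) ^ 2 = ∑ x, (Ψ (t * x) - Ψ x) ^ 2 :=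
        Equiv.sum_comp (Equiv.mulLeft l.prod) (fun x => (Ψ (t * x) - Ψ x) ^ 2)
      have h4 : ∑ x, (Ψ ((t :: l).prod * x) - Ψ x) ^ 2 ≤
          ∑ x, (2 * (Ψ (t * (l.prod * x)) - Ψ (l.prod * x)) ^ 2 +
            2 * (Ψ (l.prod * x) - Ψ x) ^ 2) := by
        refine Finset.sum_le_sum fun x _ => ?_
        rw [List.prod_cons, mul_assoc]
        nlinarith [sq_nonneg ((Ψ (t * (l.prod * x)) - Ψ (l.prod * x)) -
          (Ψ (l.prod * x) - Ψ x))]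
      rw [Finset.sum_add_distrib, ← Finset.mul_sum, ← Finset.mul_sum, h3] at h4
      rw [List.length_cons, pow_succ]
      nlinarith
  have h2 : ∀ g : G, ∑ x, (Ψ (g * x) - Ψ x) ^ 2 ≤ 2 * 2 ^ K * E := by
    intro g
    obtain ⟨l, hlK, hl, rfl⟩ := hgen g
    refine (h1 l hl).trans ?_
    have : (2 : ℝ) ^ l.length ≤ 2 ^ K := pow_le_pow_right₀ (by norm_num) hlK
    gcongr
    linarith
  have h3 := Finset.sum_le_sum fun g (_ : g ∈ (Finset.univ : Finset G)) => h2 g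
  have h4 : ∑ g : G, ∑ x, (Ψ (g * x) - Ψ x) ^ 2 = 2 * Fintype.card G * ∑ x, Ψ x ^ 2 := by
    rw [Finset.sum_comm]
    have h5 : ∀ x, ∑ g : G, (Ψ (g * x) - Ψ x) ^ 2 =
        ∑ y, Ψ y ^ 2 + Fintype.card G * Ψ x ^ 2 := by
      intro x
      refine (Equiv.sum_comp (Equiv.mulRight x) (fun y => (Ψ y - Ψ x) ^ 2)).trans ?_
      have : ∀ y, (Ψ y - Ψ x) ^ 2 = Ψ y ^ 2 - 2 * Ψ x * Ψ y + Ψ x ^ 2 := fun y => by ring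
      simp only [this, Finset.sum_add_distrib, Finset.sum_sub_distrib, ← Finset.mul_sum, hΨ]
      simp
    simp only [h5, Finset.sum_add_distrib, ← Finset.mul_sum, Finset.sum_const, Finset.card_univ,
      nsmul_eq_mul]
    ring
  rw [h4, Finset.sum_const, Finset.card_univ, nsmul_eq_mul] at h3
  have hG : (0 : ℝ) < Fintype.card G := Nat.cast_pos.mpr Fintype.card_pos
  have : (Fintype.card G : ℝ) * ∑ x, Ψ x ^ 2 ≤ Fintype.card G * (2 ^ K * E) := by linarith
  exact le_of_mul_le_mul_left this hG

theorem correlation_sq_le {G V L : Type*} [Group G] [Fintype G] [DecidableEq G] [AddCommGroup V]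
    [Fintype V] [Fintype L] [DecidableEq V] (ι : V → G) (hι : ∀ v w, ι (v + w) = ι v * ι w)
    (χ : L → AddChar V ℂ)
    (hinj : Function.Injective χ) (ℓ₀ : L) (hℓ₀ : ∀ v, χ ℓ₀ v = 1)
    (hsum : ∀ v, ∑ ℓ, χ ℓ v = if v = 0 then (Fintype.card V : ℂ) else 0)
    (d : ℕ) (hd : ∀ ℓ, ℓ ≠ ℓ₀ → ∃ O : Finset L, d ≤ O.card ∧ ∀ ℓ' ∈ O, ∃ (s : G) (a : V → V),
      ∀ v, s⁻¹ * ι v * s = ι (a v) ∧ χ ℓ (a v) = χ ℓ' v)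
    (K : ℕ) (hgen : ∀ g : G, ∃ l : List G, l.length ≤ K ∧
      (∀ t ∈ l, ∃ (s : G) (v : V), t = s * ι v * s⁻¹) ∧ l.prod = g)
    (F : G → ℝ) (hF : ∀ g x, F (g * x * g⁻¹) = F x) (hF0 : ∑ x, F x = 0) (g : G) :
    (∑ x, F (g * x) * F x) ^ 2 * (d : ℝ) ^ 2 ≤
      4 * 2 ^ K * ((Finset.univ.filter fun h : G => h * g = g * h).card : ℝ) *
        (∑ x, F x ^ 2) ^ 2 := by
  have hG : (0 : ℝ) < Fintype.card G := Nat.cast_pos.mpr Fintype.card_pos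
  have hV : (0 : ℝ) < Fintype.card V := Nat.cast_pos.mpr Fintype.card_pos
  set f : G → ℝ := fun z =>
    (Fintype.card G : ℝ)⁻¹ * ((Finset.univ.filter fun h : G => h * g * h⁻¹ = z).card : ℝ) with hf
  set Ψ : G → ℝ := fun x => ∑ y, f (x * y⁻¹) * F y with hΨ
  have hfc : ∀ k x, f (k * x * k⁻¹) = f x := by
    intro k x
    simp only [hf]
    congr 2
    refine Finset.card_bij (fun h _ => k⁻¹ * h) ?_ ?_ ?_
    · intro h hh
      simp only [Finset.mem_filter, Finset.mem_univ, true_and] at hh ⊢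
      rw [show k⁻¹ * h * g * (k⁻¹ * h)⁻¹ = k⁻¹ * (h * g * h⁻¹) * k by group, hh]; group
    · intro a _ b _ hab
      exact mul_left_cancel hab
    · intro b hb
      simp only [Finset.mem_filter, Finset.mem_univ, true_and] at hb
      refine ⟨k * b, ?_, by group⟩
      simp only [Finset.mem_filter, Finset.mem_univ, true_and]
      rw [← hb]; group
  have hfsq : Fintype.card G * ∑ z, f z ^ 2 =
      ((Finset.univ.filter fun h : G => h * g = g * h).card : ℝ) := by
    simp only [hf, mul_pow, ← Finset.mul_sum, sum_sq_card_conj_eq]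
    field_simp
  have hΨ' : ∀ x, Ψ x = (Fintype.card G : ℝ)⁻¹ * ∑ h : G, F (h * g⁻¹ * h⁻¹ * x) := by
    intro x
    simp only [hΨ, hf]
    have : ∀ y, ((Finset.univ.filter fun h : G => h * g * h⁻¹ = x * y⁻¹).card : ℝ) =
        ∑ h : G, if y = h * g⁻¹ * h⁻¹ * x then 1 else 0 := by
      intro y
      rw [Finset.sum_boole]
      congr 2
      ext h
      simp only [Finset.mem_filter, Finset.mem_univ, true_and]
      constructor
      · intro hh
        have : h * g⁻¹ * h⁻¹ = (x * y⁻¹)⁻¹ := by rw [← hh]; group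
        rw [this]; group
      · rintro rfl; group
    simp only [this]
    simp only [mul_assoc, ← Finset.mul_sum]
    congr 1
    simp only [Finset.sum_mul]
    rw [Finset.sum_comm]
    refine Finset.sum_congr rfl fun h _ => ?_
    simp
  have hΨ0 : ∑ x, Ψ x = 0 := by
    simp only [hΨ', ← Finset.mul_sum]
    rw [Finset.sum_comm]
    have : ∀ h : G, ∑ x, F (h * g⁻¹ * h⁻¹ * x) = 0 := fun h => by
      rw [← hF0]; exact Equiv.sum_comp (Equiv.mulLeft (h * g⁻¹ * h⁻¹)) F
    simp [this]
  have hΨc : ∀ k x, Ψ (k * x * k⁻¹) = Ψ x := by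
    intro k x
    simp only [hΨ]
    rw [← Equiv.sum_comp ((Equiv.mulLeft k).trans (Equiv.mulRight k⁻¹))
      (fun y => f (k * x * k⁻¹ * y⁻¹) * F y)]
    refine Finset.sum_congr rfl fun y _ => ?_
    simp only [Equiv.trans_apply, Equiv.coe_mulLeft, Equiv.coe_mulRight, hF]
    rw [← hfc k (x * y⁻¹)]
    congr 2
    group
  have hinner : ∑ x, Ψ x * F x = ∑ x, F (g * x) * F x := by
    have h1 : ∀ h : G, ∑ x, F (h * g⁻¹ * h⁻¹ * x) * F x = ∑ x, F (g * x) * F x := by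
      intro h
      rw [← Equiv.sum_comp ((Equiv.mulLeft (h * g)).trans (Equiv.mulRight h⁻¹))
        (fun x => F (h * g⁻¹ * h⁻¹ * x) * F x)]
      refine Finset.sum_congr rfl fun x _ => ?_
      simp only [Equiv.trans_apply, Equiv.coe_mulLeft, Equiv.coe_mulRight]
      rw [show h * g⁻¹ * h⁻¹ * (h * g * x * h⁻¹) = h * x * h⁻¹ by group,
        show h * g * x * h⁻¹ = h * (g * x) * h⁻¹ by group, hF, hF, mul_comm]
    simp only [hΨ', Finset.mul_sum, Finset.sum_mul]
    rw [Finset.sum_comm]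
    have h2 : ∀ h : G, ∑ x, (Fintype.card G : ℝ)⁻¹ * F (h * g⁻¹ * h⁻¹ * x) * F x =
        (Fintype.card G : ℝ)⁻¹ * ∑ x, F (g * x) * F x := fun h => by
      rw [← h1 h, Finset.mul_sum]
      exact Finset.sum_congr rfl fun x _ => by ring
    rw [Finset.sum_congr rfl fun h _ => h2 h, Finset.sum_const, Finset.card_univ, nsmul_eq_mul]
    field_simp
  set P : G → ℝ := fun x => (Fintype.card V : ℝ)⁻¹ * ∑ v, Ψ (ι v * x) with hP
  set E : ℝ := ∑ x, (Ψ x - P x) ^ 2 with hEdef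
  have hE : E * (d : ℝ) ^ 2 ≤
      ((Finset.univ.filter fun h : G => h * g = g * h).card : ℝ) * ∑ x, F x ^ 2 := by
    have := convolution_sub_average_bound ι hι χ hinj ℓ₀ hℓ₀ hsum d hd
      (fun x => (f x : ℂ)) (fun x => (F x : ℂ)) (fun x => (Ψ x : ℂ))
      (fun k x => by simp only [hfc]) (fun k x => by simp only [hF])
      (fun x => by simp only [hΨ]; push_cast; rfl)
    have h3 : ∀ x, ‖((Ψ x : ℝ) : ℂ) - (Fintype.card V : ℂ)⁻¹ * ∑ v, ((Ψ (ι v * x) : ℝ) : ℂ)‖ ^ 2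
        = (Ψ x - P x) ^ 2 := by
      intro x
      rw [← sq_abs (Ψ x - P x), ← Real.norm_eq_abs, ← Complex.norm_real]
      simp only [hP]
      push_cast
      rfl
    simp only [h3, Complex.norm_real, Real.norm_eq_abs, sq_abs] at this
    rwa [hfsq] at this
  have hPinv : ∀ v x, P (ι v * x) = P x := by
    intro v x
    simp only [hP]
    congr 1
    rw [← Equiv.sum_comp (Equiv.addRight v) (fun w => Ψ (ι w * x))]
    simp only [Equiv.coe_addRight, hι, mul_assoc]
  have hE0 : 0 ≤ E := Finset.sum_nonneg fun _ _ => sq_nonneg _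
  have hιΨ : ∀ v, ∑ x, (Ψ (ι v * x) - Ψ x) ^ 2 ≤ 4 * E := by
    intro v
    have h1 : ∑ x, (Ψ (ι v * x) - P (ι v * x)) ^ 2 = E :=
      Equiv.sum_comp (Equiv.mulLeft (ι v)) (fun x => (Ψ x - P x) ^ 2)
    calc ∑ x, (Ψ (ι v * x) - Ψ x) ^ 2
        ≤ ∑ x, (2 * (Ψ (ι v * x) - P (ι v * x)) ^ 2 + 2 * (Ψ x - P x) ^ 2) := by
          refine Finset.sum_le_sum fun x _ => ?_
          rw [hPinv]
          nlinarith [sq_nonneg ((Ψ (ι v * x) - P x) + (Ψ x - P x))]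
      _ = 4 * E := by
          rw [Finset.sum_add_distrib, ← Finset.mul_sum, ← Finset.mul_sum, h1]; ring
  have hnorm := sum_sq_le_of_bounded_generation {t | ∃ (s : G) (v : V), t = s * ι v * s⁻¹} K
    hgen Ψ hΨ0 (4 * E) (by positivity) (by
      rintro _ ⟨s, v, rfl⟩
      refine le_trans (le_of_eq ?_) (hιΨ v)
      rw [← Equiv.sum_comp ((Equiv.mulLeft s).trans (Equiv.mulRight s⁻¹))
        (fun x => (Ψ (s * ι v * s⁻¹ * x) - Ψ x) ^ 2)]
      refine Finset.sum_congr rfl fun x _ => ?_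
      simp only [Equiv.trans_apply, Equiv.coe_mulLeft, Equiv.coe_mulRight]
      rw [show s * ι v * s⁻¹ * (s * x * s⁻¹) = s * (ι v * x) * s⁻¹ by group, hΨc, hΨc])
  have hCS := Finset.sum_mul_sq_le_sq_mul_sq Finset.univ Ψ F
  rw [hinner] at hCS
  have hS : 0 ≤ ∑ x, F x ^ 2 := Finset.sum_nonneg fun _ _ => sq_nonneg _
  calc (∑ x, F (g * x) * F x) ^ 2 * (d : ℝ) ^ 2
      ≤ ((2 ^ K * (4 * E)) * ∑ x, F x ^ 2) * (d : ℝ) ^ 2 := by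
        gcongr
        exact hCS.trans (by gcongr)
    _ = 4 * 2 ^ K * (E * (d : ℝ) ^ 2) * ∑ x, F x ^ 2 := by ring
    _ ≤ 4 * 2 ^ K * (((Finset.univ.filter fun h : G => h * g = g * h).card : ℝ) *
          ∑ x, F x ^ 2) * ∑ x, F x ^ 2 := by gcongr
    _ = _ := by ring

/-- The product `∏ (h g h⁻¹)(h' g⁻¹ h'⁻¹)` over the pairs `(h, h')` of a tuple. -/
def conjWord {G : Type*} [Group G] (g : G) {m : ℕ} (p : Fin m → G × G) : G :=
  (List.ofFn fun i => (p i).1 * g * (p i).1⁻¹ * ((p i).2 * g⁻¹ * (p i).2⁻¹)).prod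

theorem conjWord_cons {G : Type*} [Group G] (g : G) {m : ℕ} (a : G × G) (p : Fin m → G × G) :
    conjWord g (Fin.cons a p : Fin (m + 1) → G × G) =
      a.1 * g * a.1⁻¹ * (a.2 * g⁻¹ * a.2⁻¹) * conjWord g p := by
  simp [conjWord, List.ofFn_succ]

theorem correlation_pow_le {G : Type*} [Group G] [Fintype G] [DecidableEq G] (g : G)
    (F₁ F₂ : G → ℝ) (hF₁ : ∀ g x, F₁ (g * x * g⁻¹) = F₁ x) (hF₂ : ∀ g x, F₂ (g * x * g⁻¹) = F₂ x)
    (j : ℕ) (good : G → Prop) [DecidablePred good] (η β : ℝ)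
    (hη : ∀ w, good w → |∑ x, F₁ (w * x) * F₁ x| ≤ η * ∑ x, F₁ x ^ 2) (hη0 : 0 ≤ η)
    (hβ : ((Finset.univ.filter fun p : Fin (2 ^ j) → G × G => ¬ good (conjWord g p)).card : ℝ) ≤
      β * (Fintype.card (G × G) : ℝ) ^ 2 ^ j) :
    ((∑ x, F₁ (g * x) * F₂ x) ^ 2) ^ 2 ^ j ≤
      (β + η) * (∑ x, F₁ x ^ 2) ^ 2 ^ j * (∑ x, F₂ x ^ 2) ^ 2 ^ j := by
  set S : ℝ := ∑ x, F₁ x ^ 2 with hS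
  have hS0 : 0 ≤ S := Finset.sum_nonneg fun _ _ => sq_nonneg _
  set N : ℝ := (Fintype.card (G × G) : ℝ) with hN
  have hN0 : 0 < N := Nat.cast_pos.mpr Fintype.card_pos
  have hG : (0 : ℝ) < Fintype.card G := Nat.cast_pos.mpr Fintype.card_pos
  set r : G × G → G := fun a => a.1 * g * a.1⁻¹ * (a.2 * g⁻¹ * a.2⁻¹) with hr
  set U : (G → ℝ) → G → ℝ := fun F x => N⁻¹ * ∑ a : G × G, F (r a * x) with hU
  have hUsymm : ∀ F H : G → ℝ, ∑ x, U F x * H x = ∑ x, F x * U H x := by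
    intro F H
    simp only [hU, Finset.mul_sum, Finset.sum_mul]
    rw [Finset.sum_comm]
    conv_rhs => rw [Finset.sum_comm]
    rw [← Equiv.sum_comp (Equiv.prodComm G G)
      (fun a => ∑ x, F x * (N⁻¹ * H (r a * x)))]
    refine Finset.sum_congr rfl fun a _ => ?_
    rw [← Equiv.sum_comp (Equiv.mulLeft (r a)⁻¹) (fun x => N⁻¹ * F (r a * x) * H x)]
    refine Finset.sum_congr rfl fun x _ => ?_
    simp only [Equiv.coe_mulLeft]
    rw [show r a * ((r a)⁻¹ * x) = x by group,
      show (r a)⁻¹ = r (Equiv.prodComm G G a) by simp only [hr, Equiv.prodComm_apply, Prod.swap]; group]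
    ring
  have hUsymm' : ∀ (m : ℕ) (F H : G → ℝ), ∑ x, U^[m] F x * H x = ∑ x, F x * U^[m] H x := by
    intro m
    induction m with
    | zero => intro F H; rfl
    | succ m ih =>
      intro F H
      rw [Function.iterate_succ_apply, ih, hUsymm, ← Function.iterate_succ_apply' U]
  set Q : ℝ := ∑ x, U F₁ x * F₁ x with hQ
  have hQpow : ∀ i, 0 ≤ Q → Q ^ 2 ^ i ≤ (∑ x, U^[2 ^ i] F₁ x * F₁ x) * S ^ (2 ^ i - 1) := by
    intro i hQ0
    induction i with
    | zero => simp [hQ]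
    | succ i ih =>
      have h1 : (∑ x, U^[2 ^ i] F₁ x * F₁ x) ^ 2 ≤ (∑ x, U^[2 ^ (i + 1)] F₁ x * F₁ x) * S := by
        refine (Finset.sum_mul_sq_le_sq_mul_sq _ _ _).trans (le_of_eq ?_)
        congr 1
        rw [pow_succ, mul_two, Function.iterate_add_apply, hUsymm']
        exact Finset.sum_congr rfl fun x _ => by rw [sq]
      have hpos : 0 < 2 ^ i := by positivity
      calc Q ^ 2 ^ (i + 1) = (Q ^ 2 ^ i) ^ 2 := by rw [← pow_mul, pow_succ]
        _ ≤ ((∑ x, U^[2 ^ i] F₁ x * F₁ x) * S ^ (2 ^ i - 1)) ^ 2 :=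
            pow_le_pow_left₀ (by positivity) ih 2
        _ = (∑ x, U^[2 ^ i] F₁ x * F₁ x) ^ 2 * (S ^ (2 ^ i - 1)) ^ 2 := by rw [mul_pow]
        _ ≤ ((∑ x, U^[2 ^ (i + 1)] F₁ x * F₁ x) * S) * (S ^ (2 ^ i - 1)) ^ 2 := by gcongr
        _ = (∑ x, U^[2 ^ (i + 1)] F₁ x * F₁ x) * (S ^ (1 + (2 ^ i - 1) * 2)) := by
            rw [pow_add S, pow_one, pow_mul S]; ring
        _ = _ := by
            congr 2
            rw [pow_succ]; omega
  have hUiter : ∀ (m : ℕ) (F : G → ℝ) (x : G), U^[m] F x =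
      (N ^ m)⁻¹ * ∑ p : Fin m → G × G, F (conjWord g p * x) := by
    intro m
    induction m with
    | zero => intro F x; simp [conjWord]
    | succ m ih =>
      intro F x
      rw [Function.iterate_succ_apply, ih, ← Equiv.sum_comp (Fin.consEquiv fun _ => G × G),
        Fintype.sum_prod_type, Finset.sum_comm, pow_succ, mul_inv, mul_assoc]
      congr 1
      rw [Finset.mul_sum]
      refine Finset.sum_congr rfl fun p _ => ?_
      simp only [hU]
      congr 1
      refine Finset.sum_congr rfl fun a _ => ?_
      have : conjWord g (Fin.consEquiv (fun _ => G × G) (a, p)) = r a * conjWord g p :=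
        conjWord_cons g a p
      rw [this, mul_assoc (r a)]
  have hcorr : ∀ w, |∑ x, F₁ (w * x) * F₁ x| ≤ S := by
    intro w
    have h1 := Finset.sum_mul_sq_le_sq_mul_sq Finset.univ (fun x => F₁ (w * x)) F₁
    have h2 : ∑ x, F₁ (w * x) ^ 2 = S := Equiv.sum_comp (Equiv.mulLeft w) (fun x => F₁ x ^ 2)
    rw [h2, ← hS, ← sq] at h1
    exact abs_le_of_sq_le_sq h1 hS0
  have hiter : ∑ x, U^[2 ^ j] F₁ x * F₁ x ≤ (β + η) * S := by
    simp only [hUiter, Finset.mul_sum, Finset.sum_mul]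
    rw [Finset.sum_comm]
    simp only [mul_assoc, ← Finset.mul_sum]
    rw [inv_mul_le_iff₀ (by positivity)]
    calc ∑ p : Fin (2 ^ j) → G × G, ∑ x, F₁ (conjWord g p * x) * F₁ x
        ≤ ∑ p : Fin (2 ^ j) → G × G, ((if ¬ good (conjWord g p) then 1 else 0) * S + η * S) := by
          refine Finset.sum_le_sum fun p _ => ?_
          refine (le_abs_self _).trans ?_
          split_ifs with h
          · have := hη _ h
            linarith
          · have := hcorr (conjWord g p)
            have : 0 ≤ η * S := by positivity
            linarith
      _ = ((Finset.univ.filter fun p : Fin (2 ^ j) → G × G => ¬ good (conjWord g p)).card : ℝ) * S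
            + N ^ 2 ^ j * (η * S) := by
          rw [Finset.sum_add_distrib, ← Finset.sum_mul, Finset.sum_boole, Finset.sum_const,
            Finset.card_univ, Fintype.card_fun, Fintype.card_fin, nsmul_eq_mul]
          push_cast
          rfl
      _ ≤ (β * N ^ 2 ^ j) * S + N ^ 2 ^ j * (η * S) := by gcongr
      _ = _ := by ring
  set T : G → ℝ := fun x => (Fintype.card G : ℝ)⁻¹ * ∑ h : G, F₁ (h * g * h⁻¹ * x) with hT
  have hB : ∑ x, T x * F₂ x = ∑ x, F₁ (g * x) * F₂ x := by
    have h1 : ∀ h : G, ∑ x, F₁ (h * g * h⁻¹ * x) * F₂ x = ∑ x, F₁ (g * x) * F₂ x := by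
      intro h
      rw [← Equiv.sum_comp ((Equiv.mulLeft h).trans (Equiv.mulRight h⁻¹))
        (fun x => F₁ (h * g * h⁻¹ * x) * F₂ x)]
      refine Finset.sum_congr rfl fun x _ => ?_
      simp only [Equiv.trans_apply, Equiv.coe_mulLeft, Equiv.coe_mulRight]
      rw [hF₂, show h * g * h⁻¹ * (h * x * h⁻¹) = h * (g * x) * h⁻¹ by group, hF₁]
    simp only [hT, Finset.mul_sum, Finset.sum_mul]
    rw [Finset.sum_comm]
    simp only [mul_assoc, ← Finset.mul_sum]
    simp only [← mul_assoc, h1]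
    rw [Finset.sum_const, Finset.card_univ, nsmul_eq_mul]
    field_simp
  have hTQ : ∑ x, T x ^ 2 = Q := by
    have h1 : ∀ h k : G, ∑ x, F₁ (h * g * h⁻¹ * x) * F₁ (k * g * k⁻¹ * x) =
        ∑ x, F₁ (r (h, k) * x) * F₁ x := by
      intro h k
      rw [← Equiv.sum_comp (Equiv.mulLeft (k * g⁻¹ * k⁻¹))
        (fun x => F₁ (h * g * h⁻¹ * x) * F₁ (k * g * k⁻¹ * x))]
      refine Finset.sum_congr rfl fun x _ => ?_
      simp only [Equiv.coe_mulLeft, hr]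
      rw [show k * g * k⁻¹ * (k * g⁻¹ * k⁻¹ * x) = x by group]
      simp only [mul_assoc]
    have h2 : ∀ x, T x ^ 2 = N⁻¹ * ∑ h : G, ∑ k : G,
        F₁ (h * g * h⁻¹ * x) * F₁ (k * g * k⁻¹ * x) := by
      intro x
      simp only [hT, hN, Fintype.card_prod]
      rw [mul_pow, sq (∑ h : G, F₁ (h * g * h⁻¹ * x)), Finset.sum_mul_sum]
      push_cast
      rw [mul_inv, sq]
    simp only [h2, hQ, hU]
    rw [← Finset.mul_sum, Finset.sum_comm]
    have h3 : ∀ h : G, ∑ x, ∑ k : G, F₁ (h * g * h⁻¹ * x) * F₁ (k * g * k⁻¹ * x) =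
        ∑ k : G, ∑ x, F₁ (r (h, k) * x) * F₁ x := fun h => by
      rw [Finset.sum_comm]
      exact Finset.sum_congr rfl fun k _ => h1 h k
    simp only [h3]
    rw [← Fintype.sum_prod_type' (f := fun h k => ∑ x, F₁ (r (h, k) * x) * F₁ x), Finset.sum_comm,
      Finset.mul_sum]
    refine Finset.sum_congr rfl fun x _ => ?_
    rw [← Finset.sum_mul, mul_assoc]
  have hQ0 : 0 ≤ Q := by rw [← hTQ]; exact Finset.sum_nonneg fun _ _ => sq_nonneg _
  have hCS := Finset.sum_mul_sq_le_sq_mul_sq Finset.univ T F₂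
  rw [hB, hTQ] at hCS
  calc ((∑ x, F₁ (g * x) * F₂ x) ^ 2) ^ 2 ^ j ≤ (Q * ∑ x, F₂ x ^ 2) ^ 2 ^ j :=
        pow_le_pow_left₀ (sq_nonneg _) hCS _
    _ = Q ^ 2 ^ j * (∑ x, F₂ x ^ 2) ^ 2 ^ j := by rw [mul_pow]
    _ ≤ ((∑ x, U^[2 ^ j] F₁ x * F₁ x) * S ^ (2 ^ j - 1)) * (∑ x, F₂ x ^ 2) ^ 2 ^ j := by
        gcongr
        exact hQpow j hQ0
    _ ≤ (((β + η) * S) * S ^ (2 ^ j - 1)) * (∑ x, F₂ x ^ 2) ^ 2 ^ j := by gcongr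
    _ = (β + η) * (S * S ^ (2 ^ j - 1)) * (∑ x, F₂ x ^ 2) ^ 2 ^ j := by ring
    _ = _ := by
        rw [← pow_succ', Nat.sub_add_cancel Nat.one_le_two_pow]

section

open Matrix

theorem det_one_add_vecMulVec' {R : Type*} [CommRing R] {n : ℕ} (u φ : Fin n → R) :
    (1 + vecMulVec u φ).det = 1 + φ ⬝ᵥ u := by
  rw [vecMulVec_eq (Fin 1), det_one_add_replicateCol_mul_replicateRow]

/-- The transvection `1 + u φ` with `φ u = 0`. -/
def rankOneTransvection {R : Type*} [CommRing R] {n : ℕ} (u φ : Fin n → R) (h : φ ⬝ᵥ u = 0) :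
    SpecialLinearGroup (Fin n) R :=
  ⟨1 + vecMulVec u φ, by rw [det_one_add_vecMulVec', h, add_zero]⟩

theorem coe_rankOneTransvection {R : Type*} [CommRing R] {n : ℕ} (u φ : Fin n → R)
    (h : φ ⬝ᵥ u = 0) : (rankOneTransvection u φ h : Matrix (Fin n) (Fin n) R) =
      1 + vecMulVec u φ := rfl

theorem exists_linearIndependent_extension {F V : Type*} [Field F] [AddCommGroup V] [Module F V]
    {k n : ℕ} (hkn : k ≤ n) (hn : n ≤ Module.finrank F V) (v : Fin k → V)
    (hv : LinearIndependent F v) :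
    ∃ w : Fin n → V, LinearIndependent F w ∧ ∀ i, w (Fin.castLE hkn i) = v i := by
  induction n, hkn using Nat.le_induction with
  | base => exact ⟨v, hv, fun i => rfl⟩
  | succ n hkn ih =>
    obtain ⟨w, hw, hwv⟩ := ih (by omega)
    obtain ⟨x, hx⟩ := exists_linearIndependent_snoc_of_lt_finrank hw (by omega)
    refine ⟨Fin.snoc w x, hx, fun i => ?_⟩
    rw [← hwv i]
    exact Fin.snoc_castSucc (α := fun _ => V) x w (Fin.castLE hkn i)

theorem exists_specialLinear_rows {F : Type*} [Field F] {k n : ℕ} (hkn : k < n)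
    (v : Fin k → Fin n → F) (hv : LinearIndependent F v) :
    ∃ s : SpecialLinearGroup (Fin n) F, ∀ i, s.1 (Fin.castLE hkn.le i) = v i := by
  obtain ⟨w, hw, hwv⟩ := exists_linearIndependent_extension hkn.le (by simp) v hv
  have hdet : (Matrix.of w).det ≠ 0 := by
    have := (Matrix.linearIndependent_rows_iff_isUnit (A := Matrix.of w)).mp hw
    exact ((Matrix.isUnit_iff_isUnit_det _).mp this).ne_zero
  let l : Fin n := ⟨n - 1, by omega⟩
  refine ⟨⟨(Matrix.of w).updateRow l ((Matrix.of w).det⁻¹ • w l), ?_⟩, fun i => ?_⟩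
  · have h := Matrix.det_updateRow_smul (Matrix.of w) l (Matrix.of w).det⁻¹ (w l)
    rw [h, show (Matrix.of w).updateRow l (w l) = Matrix.of w from Matrix.updateRow_eq_self _ _,
      inv_mul_cancel₀ hdet]
  · have : Fin.castLE hkn.le i ≠ l := by
      intro h
      have := congrArg Fin.val h
      simp only [Fin.val_castLE, l] at this
      omega
    change (Matrix.of w).updateRow l _ _ = _
    rw [Matrix.updateRow_ne this, ← hwv i]
    rfl

theorem exists_specialLinear_two_rows {F : Type*} [Field F] {m : ℕ} (φ₁ φ₂ : Fin (m + 2) → F)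
    (h : LinearIndependent F ![φ₁, φ₂]) :
    ∃ (s : SpecialLinearGroup (Fin (m + 2)) F) (c : F), c ≠ 0 ∧ (1 ≤ m → c = 1) ∧
      s.1 0 = φ₁ ∧ s.1 1 = c • φ₂ := by
  rcases m with _ | m
  · have hdet : (Matrix.of ![φ₁, φ₂]).det ≠ 0 := by
      have := (Matrix.linearIndependent_rows_iff_isUnit (A := Matrix.of ![φ₁, φ₂])).mp h
      exact ((Matrix.isUnit_iff_isUnit_det _).mp this).ne_zero
    have hd2 := hdet
    rw [det_fin_two] at hd2
    simp only [of_apply, cons_val_zero, cons_val_one] at hd2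
    refine ⟨⟨Matrix.of ![φ₁, (Matrix.of ![φ₁, φ₂]).det⁻¹ • φ₂], ?_⟩,
      (Matrix.of ![φ₁, φ₂]).det⁻¹, inv_ne_zero hdet, by omega, rfl, rfl⟩
    rw [det_fin_two, det_fin_two]
    simp only [of_apply, cons_val_zero, cons_val_one, Pi.smul_apply, smul_eq_mul]
    field_simp
  · obtain ⟨s, hs⟩ := exists_specialLinear_rows (by omega : 2 < m + 1 + 2) ![φ₁, φ₂] h
    refine ⟨s, 1, one_ne_zero, fun _ => rfl, hs 0, ?_⟩
    rw [one_smul]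
    exact hs 1

theorem vecMul_specialLinear_mul {R : Type*} [CommRing R] {n : ℕ} (φ : Fin n → R)
    (s t : SpecialLinearGroup (Fin n) R) : φ ᵥ* (s * t).1 = (φ ᵥ* s.1) ᵥ* t.1 := by
  rw [Matrix.vecMul_vecMul]; rfl

/-- `SL_n` acts transitively on pairs of linearly independent rows, up to a scalar that is only
needed when `n = 2`. -/
theorem exists_specialLinear_vecMul {F : Type*} [Field F] {m : ℕ}
    (φ₁ φ₂ ψ₁ ψ₂ : Fin (m + 2) → F)
    (hφ : LinearIndependent F ![φ₁, φ₂]) (hψ : LinearIndependent F ![ψ₁, ψ₂]) :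
    ∃ (s : SpecialLinearGroup (Fin (m + 2)) F) (c : F), c ≠ 0 ∧ (1 ≤ m → c = 1) ∧
      φ₁ ᵥ* s.1 = ψ₁ ∧ φ₂ ᵥ* s.1 = c • ψ₂ := by
  obtain ⟨s, a, ha, ha1, hs0, hs1⟩ := exists_specialLinear_two_rows φ₁ φ₂ hφ
  obtain ⟨t, b, hb, hb1, ht0, ht1⟩ := exists_specialLinear_two_rows ψ₁ ψ₂ hψ
  have h1 : ∀ i : Fin (m + 2), (s.1 i) ᵥ* (s⁻¹ * t).1 = t.1 i := by
    intro i
    have h2 : ∀ r : SpecialLinearGroup (Fin (m + 2)) F, r.1 i = Pi.single i 1 ᵥ* r.1 := by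
      intro r; rw [Matrix.single_one_vecMul]; rfl
    rw [h2 s, ← vecMul_specialLinear_mul, mul_inv_cancel_left, ← h2 t]
  refine ⟨s⁻¹ * t, a⁻¹ * b, mul_ne_zero (inv_ne_zero ha) hb, fun h => ?_, ?_, ?_⟩
  · rw [ha1 h, hb1 h]; simp
  · rw [← hs0, h1, ht0]
  · have : φ₂ = a⁻¹ • s.1 1 := by rw [hs1, smul_smul, inv_mul_cancel₀ ha, one_smul]
    rw [this, Matrix.smul_vecMul, h1, ht1, smul_smul]

/-- The abelian group of transvections `1 + u e₀` with `u₀ = 0`. -/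
def columnTransvection {F : Type*} [Field F] {m : ℕ} (v : Fin (m + 1) → F) :
    SpecialLinearGroup (Fin (m + 2)) F :=
  rankOneTransvection (Fin.cons 0 v : Fin (m + 2) → F) (Pi.single 0 1) (by
    rw [single_one_dotProduct, Fin.cons_zero])

theorem columnTransvection_add {F : Type*} [Field F] {m : ℕ} (v w : Fin (m + 1) → F) :
    columnTransvection (v + w) = columnTransvection v * columnTransvection w := by
  apply Subtype.ext
  simp only [columnTransvection, Matrix.SpecialLinearGroup.coe_mul, coe_rankOneTransvection]
  have h : (Fin.cons 0 (v + w) : Fin (m + 2) → F) = Fin.cons 0 v + Fin.cons 0 w := by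
    ext i
    refine Fin.cases ?_ (fun j => ?_) i <;> simp
  rw [h, add_vecMulVec, add_mul, mul_add, mul_add, one_mul, mul_one, one_mul,
    vecMulVec_mul_vecMulVec, single_one_dotProduct, Fin.cons_zero, zero_smul, vecMulVec_zero]
  abel

theorem specialLinear_conj_columnTransvection {F : Type*} [Field F] {m : ℕ}
    (r : SpecialLinearGroup (Fin (m + 2)) F) (v w : Fin (m + 1) → F) (b : F)
    (hrow : Pi.single 0 1 ᵥ* r.1 = b • Pi.single 0 1)
    (hcol : r.1 *ᵥ Fin.cons 0 w = b • Fin.cons 0 v) :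
    r⁻¹ * columnTransvection v * r = columnTransvection w := by
  have : columnTransvection v * r = r * columnTransvection w := by
    apply Subtype.ext
    simp only [columnTransvection, Matrix.SpecialLinearGroup.coe_mul, coe_rankOneTransvection]
    rw [add_mul, mul_add, one_mul, mul_one, vecMulVec_mul, mul_vecMulVec, hrow, hcol,
      vecMulVec_smul, smul_vecMulVec]
  rw [mul_assoc, this]
  group

theorem rankOneTransvection_eq_conj {F : Type*} [Field F] {m : ℕ} (u φ : Fin (m + 2) → F)
    (h : φ ⬝ᵥ u = 0) : ∃ (s : SpecialLinearGroup (Fin (m + 2)) F) (v : Fin (m + 1) → F),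
      rankOneTransvection u φ h = s * columnTransvection v * s⁻¹ := by
  by_cases hφ : φ = 0
  · refine ⟨1, 0, ?_⟩
    apply Subtype.ext
    have h0 : (Fin.cons 0 0 : Fin (m + 2) → F) = 0 := by
      ext i
      refine Fin.cases ?_ (fun j => ?_) i <;> simp
    rw [one_mul, inv_one, mul_one, columnTransvection, coe_rankOneTransvection,
      coe_rankOneTransvection, h0, hφ, vecMulVec_zero, zero_vecMulVec]
  · obtain ⟨r, hr⟩ := exists_specialLinear_rows (by omega : 1 < m + 2) ![φ]
      (by rw [linearIndependent_unique_iff]; simpa using hφ)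
    have hr0 : Pi.single 0 1 ᵥ* r.1 = φ := by
      rw [Matrix.single_one_vecMul]; exact hr 0
    have hru : (r.1 *ᵥ u) 0 = 0 := by
      rw [← h, ← hr0, ← dotProduct_mulVec, single_one_dotProduct]
    have hcons : (Fin.cons 0 (Fin.tail (r.1 *ᵥ u)) : Fin (m + 2) → F) = r.1 *ᵥ u := by
      conv_rhs => rw [← Fin.cons_self_tail (r.1 *ᵥ u), hru]
    refine ⟨r⁻¹, Fin.tail (r.1 *ᵥ u), ?_⟩
    have : r * rankOneTransvection u φ h = columnTransvection (Fin.tail (r.1 *ᵥ u)) * r := by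
      apply Subtype.ext
      simp only [columnTransvection, Matrix.SpecialLinearGroup.coe_mul, coe_rankOneTransvection]
      rw [add_mul, mul_add, one_mul, mul_one, vecMulVec_mul, mul_vecMulVec, hr0, hcons]
    rw [mul_assoc, inv_inv, ← this]
    group

/-- Move a vector to `e_k` by at most two transvections fixing `e_i` for `i < k`. -/
theorem exists_transvections_mulVec {F : Type*} [Field F] {n : ℕ} (k : Fin n) (v : Fin n → F)
    (hv : ∃ j, k ≤ j ∧ v j ≠ 0) (hlast : k.1 + 1 = n → v k = 1) :
    ∃ l : List (SpecialLinearGroup (Fin n) F), l.length ≤ 2 ∧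
      (∀ t ∈ l, ∃ u φ h, t = rankOneTransvection u φ h) ∧
      l.prod.1 *ᵥ v = Pi.single k 1 ∧ ∀ i < k, l.prod.1 *ᵥ Pi.single i 1 = Pi.single i 1 := by
  have base : ∀ (v φ : Fin n → F), φ ⬝ᵥ v = 1 → φ k = 1 → (∀ i < k, φ i = 0) →
      ∃ t : SpecialLinearGroup (Fin n) F, (∃ u φ h, t = rankOneTransvection u φ h) ∧
      t.1 *ᵥ v = Pi.single k 1 ∧ ∀ i < k, t.1 *ᵥ Pi.single i 1 = Pi.single i 1 := by
    intro v φ h1 hk hi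
    refine ⟨rankOneTransvection (Pi.single k 1 - v) φ (by
      rw [dotProduct_sub, h1, dotProduct_single_one, hk, sub_self]), ⟨_, _, _, rfl⟩, ?_, ?_⟩
    · rw [coe_rankOneTransvection, add_mulVec, one_mulVec, vecMulVec_mulVec, h1]
      simp
    · intro i hik
      rw [coe_rankOneTransvection, add_mulVec, one_mulVec, vecMulVec_mulVec,
        dotProduct_single_one, hi i hik]
      simp
  have case1 : ∀ v : Fin n → F, (∃ j, k < j ∧ v j ≠ 0) →
      ∃ t : SpecialLinearGroup (Fin n) F, (∃ u φ h, t = rankOneTransvection u φ h) ∧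
      t.1 *ᵥ v = Pi.single k 1 ∧ ∀ i < k, t.1 *ᵥ Pi.single i 1 = Pi.single i 1 := by
    rintro v ⟨j, hkj, hj⟩
    refine base v (Pi.single k 1 + ((1 - v k) / v j) • Pi.single j 1) ?_ ?_ ?_
    · rw [add_dotProduct, smul_dotProduct, single_one_dotProduct, single_one_dotProduct,
        smul_eq_mul, div_mul_cancel₀ _ hj]
      ring
    · simp [hkj.ne]
    · intro i hi
      simp [hi.ne, (hi.trans hkj).ne]
  by_cases h1 : ∃ j, k < j ∧ v j ≠ 0
  · obtain ⟨t, ht, htv, hti⟩ := case1 v h1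
    exact ⟨[t], by simp, by simpa using ht, by simpa using htv, by simpa using hti⟩
  · push Not at h1
    have hvk : v k ≠ 0 := by
      obtain ⟨j, hkj, hj⟩ := hv
      rcases hkj.eq_or_lt with rfl | hlt
      · exact hj
      · exact absurd (h1 j hlt) hj
    by_cases hkn : k.1 + 1 = n
    · obtain ⟨t, ht, htv, hti⟩ := base v (Pi.single k 1)
        (by rw [single_one_dotProduct]; exact hlast hkn) (by simp)
        (fun i hi => by simp [hi.ne])
      exact ⟨[t], by simp, by simpa using ht, by simpa using htv, by simpa using hti⟩
    · set k' : Fin n := ⟨k.1 + 1, by omega⟩ with hk'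
      have hkk' : k < k' := by rw [Fin.lt_def]; simp [hk']
      set t₀ := rankOneTransvection (Pi.single k' 1 : Fin n → F) (Pi.single k 1)
        (by rw [dotProduct_single_one]; simp [hkk'.ne']) with ht₀
      obtain ⟨t, ht, htv, hti⟩ := case1 (t₀.1 *ᵥ v) ⟨k', hkk', by
        rw [ht₀, coe_rankOneTransvection, add_mulVec, one_mulVec, vecMulVec_mulVec,
          single_one_dotProduct]
        simpa [h1 k' hkk'] using hvk⟩
      refine ⟨[t, t₀], by simp, ?_, ?_, ?_⟩
      · intro x hx
        simp only [List.mem_cons, List.not_mem_nil, or_false] at hx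
        rcases hx with rfl | rfl
        · exact ht
        · exact ⟨_, _, _, rfl⟩
      · simp only [List.prod_cons, List.prod_nil, mul_one, Matrix.SpecialLinearGroup.coe_mul]
        rw [← mulVec_mulVec, htv]
      · intro i hi
        simp only [List.prod_cons, List.prod_nil, mul_one, Matrix.SpecialLinearGroup.coe_mul]
        rw [← mulVec_mulVec]
        have : t₀.1 *ᵥ Pi.single i 1 = Pi.single i 1 := by
          rw [ht₀, coe_rankOneTransvection, add_mulVec, one_mulVec, vecMulVec_mulVec,
            single_one_dotProduct]
          simp [hi.ne']
        rw [this, hti i hi]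

theorem exists_transvections_prod {F : Type*} [Field F] {n : ℕ}
    (g : SpecialLinearGroup (Fin n) F) :
    ∃ l : List (SpecialLinearGroup (Fin n) F), l.length ≤ 2 * n ∧
      (∀ t ∈ l, ∃ u φ h, t = rankOneTransvection u φ h) ∧ l.prod = g := by
  have main : ∀ k ≤ n, ∀ M : SpecialLinearGroup (Fin n) F,
      ∃ l : List (SpecialLinearGroup (Fin n) F), l.length ≤ 2 * k ∧
      (∀ t ∈ l, ∃ u φ h, t = rankOneTransvection u φ h) ∧
      ∀ i : Fin n, i.1 < k → (l.prod * M).1 *ᵥ Pi.single i 1 = Pi.single i 1 := by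
    intro k
    induction k with
    | zero => intro _ M; exact ⟨[], by simp, by simp, by simp⟩
    | succ k ih =>
      intro hk M
      obtain ⟨l, hl, hlt, hli⟩ := ih (by omega) M
      set k' : Fin n := ⟨k, by omega⟩ with hk'
      set M' := l.prod * M with hM'
      set v := M'.1 *ᵥ Pi.single k' 1 with hv
      have hinj : Function.Injective (M'.1 *ᵥ ·) := by
        intro x y hxy
        have := congrArg ((M'⁻¹).1 *ᵥ ·) hxy
        simp only [mulVec_mulVec, ← Matrix.SpecialLinearGroup.coe_mul, inv_mul_cancel,
          Matrix.SpecialLinearGroup.coe_one, one_mulVec] at this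
        exact this
      obtain ⟨l', hl', hlt', hlv, hli'⟩ := exists_transvections_mulVec k' v (by
        by_contra hcon
        push Not at hcon
        have h1 : M'.1 *ᵥ v = v := by
          have h2 : v = ∑ i, v i • (Pi.single i 1 : Fin n → F) := by
            ext j; simp [Finset.sum_apply, Pi.single_apply]
          conv_lhs => rw [h2]
          conv_rhs => rw [h2]
          rw [mulVec_sum]
          refine Finset.sum_congr rfl fun i _ => ?_
          by_cases hi : i.1 < k
          · rw [mulVec_smul, hli i hi]
          · rw [hcon i (by rw [Fin.le_def]; simp [hk']; omega)]; simp
        have h3 : v = Pi.single k' 1 := hinj (h1.trans hv)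
        have h4 := hcon k' le_rfl
        rw [h3] at h4
        simp at h4) (by
        intro hlast
        have hent : ∀ i j : Fin n, M'.1 i j = (M'.1 *ᵥ Pi.single j 1) i := by
          intro i j; rw [mulVec_single_one]; rfl
        have htri : M'.1.BlockTriangular id := by
          intro i j hij
          have hjk : j.1 < k := by
            have : j.1 < i.1 := hij
            have := i.2
            simp only [hk'] at hlast
            omega
          rw [hent, hli j hjk]
          simp [(show j < i from hij).ne']
        have hdet := det_of_isUpperTriangular htri
        rw [M'.2, Finset.prod_eq_single k'] at hdet
        · rw [hdet, hv, mulVec_single_one]; rfl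
        · intro i _ hi
          have : i.1 < k := by
            have h1 : i.1 ≠ k := fun h => hi (Fin.ext h)
            have := i.2
            simp only [hk'] at hlast
            omega
          rw [hent, hli i this]; simp
        · simp)
      refine ⟨l' ++ l, by simp; omega, ?_, ?_⟩
      · intro t ht
        rcases List.mem_append.mp ht with h | h
        · exact hlt' t h
        · exact hlt t h
      · intro i hi
        rw [List.prod_append, mul_assoc, ← hM', Matrix.SpecialLinearGroup.coe_mul, ← mulVec_mulVec]
        rcases Nat.lt_succ_iff_lt_or_eq.mp hi with h | h
        · rw [hli i h]
          exact hli' i h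
        · have : i = k' := Fin.ext h
          rw [this, ← hv, hlv]
  obtain ⟨l, hl, hlt, hli⟩ := main n le_rfl g⁻¹
  refine ⟨l, hl, hlt, ?_⟩
  rw [← mul_inv_eq_one]
  apply Subtype.ext
  ext i j
  have := congrFun (hli j j.2) i
  rw [mulVec_single_one] at this
  rw [Matrix.SpecialLinearGroup.coe_one, Matrix.one_apply]
  refine Eq.trans this ?_
  rw [Pi.single_apply]

theorem columnTransvection_orbit {F : Type*} [Field F] [Fintype F] {m : ℕ}
    (ℓ : Fin (m + 1) → F) (hℓ : ℓ ≠ 0) :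
    ∃ O : Finset (Fin (m + 1) → F), Fintype.card F ^ (m + 1) ≤ 4 * O.card ∧
      ∀ ℓ' ∈ O, ∃ (s : SpecialLinearGroup (Fin (m + 2)) F)
        (a : (Fin (m + 1) → F) → (Fin (m + 1) → F)), ∀ v,
        s⁻¹ * columnTransvection v * s = columnTransvection (a v) ∧ ℓ ⬝ᵥ a v = ℓ' ⬝ᵥ v := by
  classical
  have hq : 2 ≤ Fintype.card F := Fintype.one_lt_card
  rcases m with _ | m
  · set f : Fˣ → (Fin 1 → F) := fun b => ((b : F) ^ 2) • ℓ with hf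
    refine ⟨Finset.univ.image f, ?_, ?_⟩
    · have h1 : (Finset.univ : Finset Fˣ).card ≤ 2 * (Finset.univ.image f).card := by
        refine Finset.card_le_mul_card_image (f := f) Finset.univ 2 fun y hy => ?_
        obtain ⟨b, -, rfl⟩ := Finset.mem_image.mp hy
        refine (Finset.card_le_card (t := {b, -b}) ?_).trans Finset.card_le_two
        intro c hc
        have hc' : f c = f b := (Finset.mem_filter.mp hc).2
        simp only [hf] at hc'
        have h2 : (c : F) ^ 2 = (b : F) ^ 2 := by
          by_contra hne
          apply hℓ
          have h3 : ((c : F) ^ 2 - (b : F) ^ 2) • ℓ = 0 := by rw [sub_smul, hc', sub_self]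
          exact (smul_eq_zero.mp h3).resolve_left (sub_ne_zero.mpr hne)
        rcases sq_eq_sq_iff_eq_or_eq_neg.mp h2 with h | h
        · simp [Units.ext h]
        · have : c = -b := Units.ext (by simpa using h)
          simp [this]
      rw [Finset.card_univ, Fintype.card_units] at h1
      simp only [zero_add, pow_one]
      omega
    · intro ℓ' hℓ'
      obtain ⟨b, -, rfl⟩ := Finset.mem_image.mp hℓ'
      refine ⟨⟨diagonal ![(b : F), ((b⁻¹ : Fˣ) : F)], by simp⟩, fun v => ((b : F) ^ 2) • v,
        fun v => ⟨?_, by simp [hf, smul_dotProduct, dotProduct_smul]⟩⟩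
      refine specialLinear_conj_columnTransvection _ _ _ (b : F) ?_ ?_
      · ext i
        fin_cases i <;> simp [Matrix.vecMul_diagonal]
      · ext i
        fin_cases i
        · simp [Matrix.mulVec_diagonal]
        · simp only [Matrix.mulVec_diagonal]
          change ((b⁻¹ : Fˣ) : F) * ((b : F) ^ 2 * v 0) = (b : F) * v 0
          have : ((b⁻¹ : Fˣ) : F) * b = 1 := by simp
          linear_combination ((b : F) * v 0) * this
  · refine ⟨Finset.univ.erase 0, ?_, ?_⟩
    · rw [Finset.card_erase_of_mem (Finset.mem_univ _), Finset.card_univ, Fintype.card_fun,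
        Fintype.card_fin]
      have : 2 ≤ Fintype.card F ^ (m + 1 + 1) := hq.trans (Nat.le_self_pow (by omega) _)
      omega
    · intro ℓ' hℓ'
      have hli : ∀ k : Fin (m + 2) → F, k ≠ 0 →
          LinearIndependent F ![(Pi.single 0 1 : Fin (m + 1 + 2) → F), Fin.cons 0 k] := by
        intro k hk
        rw [LinearIndependent.pair_iff]
        intro a b hab
        have h0 := congrFun hab 0
        simp at h0
        refine ⟨h0, ?_⟩
        obtain ⟨i, hi⟩ := Function.ne_iff.mp hk
        have h1 := congrFun hab i.succ
        simp only [Pi.add_apply, Pi.smul_apply, Fin.cons_succ, h0, zero_smul, zero_add,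
          smul_eq_mul, Pi.zero_apply] at h1
        exact (mul_eq_zero.mp h1).resolve_right hi
      obtain ⟨s, c, -, hc1, hs0, hs1⟩ := exists_specialLinear_vecMul _ _ _ _ (hli ℓ hℓ)
        (hli ℓ' (Finset.ne_of_mem_erase hℓ'))
      rw [hc1 (by omega), one_smul] at hs1
      have hz : ∀ v : Fin (m + 2) → F, (Fin.cons 0 (Fin.tail (s.1 *ᵥ Fin.cons 0 v)) :
          Fin (m + 1 + 2) → F) = s.1 *ᵥ Fin.cons 0 v := by
        intro v
        have : (s.1 *ᵥ (Fin.cons 0 v : Fin (m + 1 + 2) → F)) 0 = 0 := by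
          rw [← single_one_dotProduct (0 : Fin (m + 1 + 2)) (s.1 *ᵥ _), dotProduct_mulVec, hs0,
            single_one_dotProduct, Fin.cons_zero]
        conv_rhs => rw [← Fin.cons_self_tail (s.1 *ᵥ (Fin.cons 0 v : Fin (m + 1 + 2) → F)), this]
      have hss : s.1 * (s⁻¹).1 = 1 := by
        rw [← Matrix.SpecialLinearGroup.coe_mul, mul_inv_cancel, Matrix.SpecialLinearGroup.coe_one]
      have hss' : (s⁻¹).1 * s.1 = 1 := by
        rw [← Matrix.SpecialLinearGroup.coe_mul, inv_mul_cancel, Matrix.SpecialLinearGroup.coe_one]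
      have hdot : ∀ k w : Fin (m + 2) → F,
          (Fin.cons 0 k : Fin (m + 1 + 2) → F) ⬝ᵥ Fin.cons 0 w = k ⬝ᵥ w := by
        intro k w
        simp [dotProduct, Fin.sum_univ_succ]
      refine ⟨s⁻¹, fun v => Fin.tail (s.1 *ᵥ Fin.cons 0 v), fun v => ⟨?_, ?_⟩⟩
      · refine specialLinear_conj_columnTransvection _ _ _ 1 ?_ ?_
        · rw [one_smul]
          conv_lhs => rw [← hs0]
          rw [vecMul_vecMul, hss, vecMul_one]
        · rw [one_smul, hz, mulVec_mulVec, hss', one_mulVec]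
      · rw [← hdot, hz, dotProduct_mulVec, hs1, hdot]

theorem specialLinear_correlation_le {F : Type} [Field F] [Fintype F] [DecidableEq F] {m : ℕ}
    (f : SpecialLinearGroup (Fin (m + 2)) F → ℝ) (hf : ∀ g x, f (g * x * g⁻¹) = f x)
    (hf0 : ∑ x, f x = 0) (g : SpecialLinearGroup (Fin (m + 2)) F) :
    (∑ x, f (g * x) * f x) ^ 2 * ((Fintype.card F : ℝ) ^ (m + 1)) ^ 2 ≤
      64 * 2 ^ (2 * (m + 2)) *
        ((Finset.univ.filter fun h : SpecialLinearGroup (Fin (m + 2)) F =>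
          h * g = g * h).card : ℝ) * (∑ x, f x ^ 2) ^ 2 := by
  classical
  set ψ := AddChar.FiniteField.primitiveChar_to_Complex F with hψ
  have hψp : ψ.IsPrimitive := AddChar.FiniteField.primitiveChar_to_Complex_isPrimitive F
  let χ : (Fin (m + 1) → F) → AddChar (Fin (m + 1) → F) ℂ := fun ℓ =>
    { toFun := fun v => ψ (ℓ ⬝ᵥ v)
      map_zero_eq_one' := by simp
      map_add_eq_mul' := fun v w => by rw [dotProduct_add, AddChar.map_add_eq_mul] }
  have hχ : ∀ ℓ v, χ ℓ v = ψ (ℓ ⬝ᵥ v) := fun _ _ => rfl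
  have hone : ∀ a : F, (∀ x, ψ (a * x) = 1) → a = 0 := by
    intro a ha
    by_contra hne
    exact hψp hne (by ext x; simpa [AddChar.mulShift_apply] using ha x)
  have hinj : Function.Injective χ := by
    intro ℓ ℓ' h
    funext i
    rw [← sub_eq_zero]
    apply hone
    intro x
    have h1 := DFunLike.congr_fun h (Pi.single i x)
    rw [hχ, hχ, dotProduct_single, dotProduct_single] at h1
    rw [sub_mul, AddChar.map_sub_eq_div, h1, div_self]
    intro h0
    have := AddChar.norm_apply ψ (ℓ' i * x)
    rw [h0] at this
    simp at this
  have hsum : ∀ v, ∑ ℓ, χ ℓ v = if v = 0 then (Fintype.card (Fin (m + 1) → F) : ℂ) else 0 := by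
    intro v
    let ev : AddChar (Fin (m + 1) → F) ℂ :=
      { toFun := fun ℓ => ψ (ℓ ⬝ᵥ v)
        map_zero_eq_one' := by simp
        map_add_eq_mul' := fun x w => by rw [add_dotProduct, AddChar.map_add_eq_mul] }
    have h1 := AddChar.sum_eq_ite ev
    have h2 : ev = 0 ↔ v = 0 := by
      constructor
      · intro h
        funext i
        apply hone
        intro x
        have h3 := DFunLike.congr_fun h (Pi.single i x)
        change ψ (Pi.single i x ⬝ᵥ v) = 1 at h3
        rwa [single_dotProduct, mul_comm] at h3
      · rintro rfl
        ext ℓ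
        change ψ (ℓ ⬝ᵥ 0) = 1
        simp
    simp only [h2] at h1
    exact h1
  set d : ℕ := (Fintype.card F ^ (m + 1) + 3) / 4 with hd
  have key := correlation_sq_le (G := SpecialLinearGroup (Fin (m + 2)) F)
    columnTransvection columnTransvection_add χ hinj 0 (fun v => by rw [hχ]; simp) hsum d
    (fun ℓ hℓ => by
      obtain ⟨O, hO, h⟩ := columnTransvection_orbit ℓ hℓ
      refine ⟨O, by omega, fun ℓ' hℓ' => ?_⟩
      obtain ⟨s, a, hs⟩ := h ℓ' hℓ'
      exact ⟨s, a, fun v => ⟨(hs v).1, by rw [hχ, hχ, (hs v).2]⟩⟩)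
    (2 * (m + 2))
    (fun g => by
      obtain ⟨l, hl, ht, hp⟩ := exists_transvections_prod g
      refine ⟨l, hl, fun t h => ?_, hp⟩
      obtain ⟨u, φ, h0, rfl⟩ := ht t h
      exact rankOneTransvection_eq_conj u φ h0) f hf hf0 g
  have hd' : (Fintype.card F : ℝ) ^ (m + 1) ≤ 4 * d := by
    have : Fintype.card F ^ (m + 1) ≤ 4 * d := by omega
    exact_mod_cast this
  have hsq : ((Fintype.card F : ℝ) ^ (m + 1)) ^ 2 ≤ (4 * d) ^ 2 := by gcongr
  have := mul_le_mul_of_nonneg_left hsq (sq_nonneg (∑ x, f (g * x) * f x))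
  nlinarith [this, key]

/-- `φ` is given by a polynomial of total degree at most `d`. -/
def IsPolynomialFunction {F σ : Type*} [Field F] (d : ℕ) (φ : (σ → F) → F) : Prop :=
  ∃ p : MvPolynomial σ F, p.totalDegree ≤ d ∧ ∀ x, MvPolynomial.eval x p = φ x

namespace IsPolynomialFunction

variable {F σ : Type*} [Field F]

theorem mono {d d' : ℕ} {φ : (σ → F) → F} (h : IsPolynomialFunction d φ) (hd : d ≤ d') :
    IsPolynomialFunction d' φ := by
  obtain ⟨p, hp, he⟩ := h
  exact ⟨p, hp.trans hd, he⟩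

theorem const (d : ℕ) (c : F) : IsPolynomialFunction d (fun _ : σ → F => c) :=
  ⟨MvPolynomial.C c, by simp, by simp⟩

theorem coord (i : σ) : IsPolynomialFunction 1 (fun x : σ → F => x i) :=
  ⟨MvPolynomial.X i, by simp, by simp⟩

theorem add {d : ℕ} {φ ψ : (σ → F) → F} (h : IsPolynomialFunction d φ)
    (h' : IsPolynomialFunction d ψ) : IsPolynomialFunction d (fun x => φ x + ψ x) := by
  obtain ⟨p, hp, he⟩ := h
  obtain ⟨p', hp', he'⟩ := h'
  exact ⟨p + p', (MvPolynomial.totalDegree_add _ _).trans (max_le hp hp'),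
    fun x => by rw [map_add, he, he']⟩

theorem mul {d d' : ℕ} {φ ψ : (σ → F) → F} (h : IsPolynomialFunction d φ)
    (h' : IsPolynomialFunction d' ψ) : IsPolynomialFunction (d + d') (fun x => φ x * ψ x) := by
  obtain ⟨p, hp, he⟩ := h
  obtain ⟨p', hp', he'⟩ := h'
  exact ⟨p * p', (MvPolynomial.totalDegree_mul _ _).trans (by omega),
    fun x => by rw [map_mul, he, he']⟩

theorem sum {ι : Type*} (s : Finset ι) {d : ℕ} {φ : ι → (σ → F) → F}
    (h : ∀ i ∈ s, IsPolynomialFunction d (φ i)) :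
    IsPolynomialFunction d (fun x => ∑ i ∈ s, φ i x) := by
  classical
  induction s using Finset.induction_on with
  | empty => simpa using const d 0
  | insert a s ha ih =>
    simp only [Finset.sum_insert ha]
    exact (h a (Finset.mem_insert_self a s)).add
      (ih fun i hi => h i (Finset.mem_insert_of_mem hi))

theorem prod {ι : Type*} (s : Finset ι) {d : ℕ} {φ : ι → (σ → F) → F}
    (h : ∀ i ∈ s, IsPolynomialFunction d (φ i)) :
    IsPolynomialFunction (s.card * d) (fun x => ∏ i ∈ s, φ i x) := by
  classical
  induction s using Finset.induction_on with
  | empty => simpa using const 0 1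
  | insert a s ha ih =>
    simp only [Finset.prod_insert ha]
    refine ((h a (Finset.mem_insert_self a s)).mul
      (ih fun i hi => h i (Finset.mem_insert_of_mem hi))).mono ?_
    rw [Finset.card_insert_of_notMem ha, add_mul, one_mul, add_comm]

theorem matrix_mul {l m n : Type*} [Fintype m] {d d' : ℕ} {A : (σ → F) → Matrix l m F}
    {B : (σ → F) → Matrix m n F} (hA : ∀ i j, IsPolynomialFunction d fun x => A x i j)
    (hB : ∀ i j, IsPolynomialFunction d' fun x => B x i j) (i : l) (j : n) :
    IsPolynomialFunction (d + d') fun x => (A x * B x) i j := by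
  simp only [Matrix.mul_apply]
  exact sum _ fun k _ => (hA i k).mul (hB k j)

theorem matrix_det {n : ℕ} {d : ℕ} {A : (σ → F) → Matrix (Fin n) (Fin n) F}
    (hA : ∀ i j, IsPolynomialFunction d fun x => A x i j) :
    IsPolynomialFunction (n * d) fun x => (A x).det := by
  simp only [Matrix.det_apply']
  refine sum _ fun s _ => ?_
  have h := (const 0 ((Equiv.Perm.sign s : ℤ) : F)).mul
    (prod Finset.univ (φ := fun i x => A x (s i) i) fun i _ => hA (s i) i)
  refine h.mono ?_
  simp

theorem matrix_adjugate {n : ℕ} {d : ℕ} {A : (σ → F) → Matrix (Fin n) (Fin n) F}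
    (hA : ∀ i j, IsPolynomialFunction d fun x => A x i j) (i j : Fin n) :
    IsPolynomialFunction (n * d) fun x => (A x).adjugate i j := by
  simp only [Matrix.adjugate_apply]
  refine matrix_det fun a b => ?_
  by_cases h : a = j
  · subst h
    simpa using const d _
  · simpa [Matrix.updateRow_ne h] using hA a b

theorem matrix_list_prod {n m d : ℕ} {A : Fin m → (σ → F) → Matrix (Fin n) (Fin n) F}
    (hA : ∀ k i j, IsPolynomialFunction d fun x => A k x i j) (i j : Fin n) :
    IsPolynomialFunction (m * d) fun x => (List.ofFn fun k => A k x).prod i j := by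
  induction m generalizing i j with
  | zero => simpa using const 0 _
  | succ m ih =>
    simp only [List.ofFn_succ, List.prod_cons]
    refine (matrix_mul (hA 0) (fun a b => ih (A := fun k => A k.succ)
      (fun k => hA k.succ) a b) i j).mono ?_
    rw [add_mul, one_mul, add_comm]

theorem matrix_pow {n d : ℕ} {A : (σ → F) → Matrix (Fin n) (Fin n) F}
    (hA : ∀ i j, IsPolynomialFunction d fun x => A x i j) (k : ℕ) (i j : Fin n) :
    IsPolynomialFunction (k * d) fun x => (A x ^ k) i j := by
  induction k generalizing i j with
  | zero => simpa using const 0 _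
  | succ k ih =>
    simp only [pow_succ]
    refine (matrix_mul ih hA i j).mono ?_
    rw [add_mul, one_mul]

theorem card_zeros_le [Fintype F] [DecidableEq F] [Fintype σ] [DecidableEq σ] {d : ℕ} {φ : (σ → F) → F}
    (h : IsPolynomialFunction d φ) (hne : ∃ x, φ x ≠ 0) :
    (Finset.univ.filter fun x => φ x = 0).card * Fintype.card F ≤
      d * Fintype.card F ^ Fintype.card σ := by
  obtain ⟨p, hp, he⟩ := h
  obtain ⟨x₀, hx₀⟩ := hne
  set e := Fintype.equivFin σ
  set p' := MvPolynomial.rename e p with hp'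
  have hp'0 : p' ≠ 0 := by
    intro h0
    have : MvPolynomial.eval (x₀ ∘ e.symm) p' = 0 := by rw [h0, map_zero]
    rw [hp', MvPolynomial.eval_rename] at this
    apply hx₀
    rw [← he, ← this]
    congr 2
    ext i
    simp
  have hsz := MvPolynomial.schwartz_zippel_totalDegree hp'0 (Finset.univ : Finset F)
  have hcard : (Finset.univ.filter fun x => φ x = 0).card =
      (Finset.filter (fun f => MvPolynomial.eval f p' = 0)
        (Fintype.piFinset fun _ : Fin (Fintype.card σ) => (Finset.univ : Finset F))).card := by
    refine Finset.card_bij (fun x _ => x ∘ e.symm) ?_ ?_ ?_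
    · intro x hx
      have hx' := (Finset.mem_filter.mp hx).2
      refine Finset.mem_filter.mpr ⟨by simp, ?_⟩
      rw [hp', MvPolynomial.eval_rename, ← hx', ← he]
      congr 2
      ext i
      simp
    · intro a _ b _ hab
      ext i
      have := congrFun hab (e i)
      simpa using this
    · intro y hy
      refine ⟨y ∘ e, ?_, by ext i; simp⟩
      have hy' := (Finset.mem_filter.mp hy).2
      refine Finset.mem_filter.mpr ⟨by simp, ?_⟩
      rw [← he, ← hy', hp', MvPolynomial.eval_rename]
  have hdeg : p'.totalDegree ≤ d := (MvPolynomial.totalDegree_rename_le _ _).trans hp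
  have hq : (0 : ℚ≥0) < (Fintype.card F : ℚ≥0) := by exact_mod_cast Fintype.card_pos
  rw [← hcard, Finset.card_univ, div_le_div_iff₀ (pow_pos hq _) hq] at hsz
  have hsz' : (Finset.univ.filter fun x => φ x = 0).card * Fintype.card F ≤
      p'.totalDegree * Fintype.card F ^ Fintype.card σ := by exact_mod_cast hsz
  exact hsz'.trans (Nat.mul_le_mul_right _ hdeg)

end IsPolynomialFunction

/-- The determinant of `e₀, w e₀, …, w ^ (n - 1) e₀`. -/
def krylovDet {F : Type*} [Field F] {m : ℕ} (w : Matrix (Fin (m + 2)) (Fin (m + 2)) F) : F :=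
  (Matrix.of fun i j : Fin (m + 2) => (w ^ (j : ℕ)) i 0).det

theorem krylovDet_smul {F : Type*} [Field F] {m : ℕ} (c : F)
    (w : Matrix (Fin (m + 2)) (Fin (m + 2)) F) :
    krylovDet (c • w) = (∏ j : Fin (m + 2), c ^ (j : ℕ)) * krylovDet w := by
  rw [krylovDet, krylovDet, ← Matrix.det_mul_row]
  congr 1
  ext i j
  simp [smul_pow]

theorem isPolynomialFunction_krylovDet {F σ : Type*} [Field F] {m d : ℕ}
    {A : (σ → F) → Matrix (Fin (m + 2)) (Fin (m + 2)) F}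
    (hA : ∀ i j, IsPolynomialFunction d fun x => A x i j) :
    IsPolynomialFunction ((m + 2) * ((m + 2) * d)) fun x => krylovDet (A x) := by
  unfold krylovDet
  refine IsPolynomialFunction.matrix_det fun i j => ?_
  refine (IsPolynomialFunction.matrix_pow hA j i 0).mono ?_
  exact Nat.mul_le_mul_right _ j.2.le

theorem card_centralizer_le {F : Type*} [Field F] [Fintype F] [DecidableEq F] {m : ℕ}
    (w : SpecialLinearGroup (Fin (m + 2)) F) (hw : krylovDet w.1 ≠ 0) :
    (Finset.univ.filter fun h : SpecialLinearGroup (Fin (m + 2)) F => h * w = w * h).card *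
      Fintype.card F ≤ (m + 2) * Fintype.card F ^ (m + 2) := by
  set K : Matrix (Fin (m + 2)) (Fin (m + 2)) F := Matrix.of fun i j => (w.1 ^ (j : ℕ)) i 0 with hK
  set Ku : (Fin (m + 2) → F) → Matrix (Fin (m + 2)) (Fin (m + 2)) F :=
    fun u => Matrix.of fun i j => ∑ k, (w.1 ^ (j : ℕ)) i k * u k with hKu
  have hKdet : K.det ≠ 0 := hw
  have hpoly : IsPolynomialFunction ((m + 2) * 1) fun u => (Ku u).det + -K.det := by
    refine IsPolynomialFunction.add (IsPolynomialFunction.matrix_det fun i j => ?_)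
      (IsPolynomialFunction.const _ _)
    simp only [hKu, Matrix.of_apply]
    refine IsPolynomialFunction.sum _ fun k _ => ?_
    exact ((IsPolynomialFunction.const 0 _).mul (IsPolynomialFunction.coord k)).mono (by omega)
  have hcount := hpoly.card_zeros_le ⟨0, by
    have : Ku 0 = 0 := by ext i j; simp [hKu]
    rw [this, Matrix.det_zero, zero_add]
    exact neg_ne_zero.mpr hKdet⟩
  rw [mul_one, Fintype.card_fin] at hcount
  refine le_trans (Nat.mul_le_mul_right _ ?_) hcount
  have hmul : ∀ h : SpecialLinearGroup (Fin (m + 2)) F, h * w = w * h →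
      h.1 * K = Ku (fun i => h.1 i 0) := by
    intro h hh
    have hpow : ∀ j : ℕ, h.1 * w.1 ^ j = w.1 ^ j * h.1 := by
      intro j
      have : h * w ^ j = w ^ j * h := (Commute.pow_right hh j)
      have := congrArg Subtype.val this
      simpa using this
    ext i j
    have := congrFun (congrFun (hpow j) i) 0
    simpa [Matrix.mul_apply, hK, hKu] using this
  refine Finset.card_le_card_of_injOn (fun h i => h.1 i 0) ?_ ?_
  · intro h hh
    have hh' := (Finset.mem_filter.mp (Finset.mem_coe.mp hh)).2
    simp only [Finset.coe_filter, Finset.mem_univ, true_and, Set.mem_ofPred_eq]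
    rw [← hmul h hh', Matrix.det_mul, h.2, one_mul, add_neg_cancel]
  · intro h hh h' hh' heq
    have hh1 := (Finset.mem_filter.mp (Finset.mem_coe.mp hh)).2
    have hh2 := (Finset.mem_filter.mp (Finset.mem_coe.mp hh')).2
    have heq' : h.1 * K = h'.1 * K := by
      rw [hmul h hh1, hmul h' hh2]
      exact congrArg Ku heq
    have hu : IsUnit K.det := IsUnit.mk0 _ hKdet
    apply Subtype.ext
    have := congrArg (· * K⁻¹) heq'
    simpa [Matrix.mul_assoc, Matrix.mul_nonsing_inv _ hu] using this

/-- `diag(δ, 1, …, 1)`. -/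
def firstDiagonal {F : Type*} [Field F] {m : ℕ} (δ : F) :
    Matrix (Fin (m + 2)) (Fin (m + 2)) F :=
  diagonal fun i => if i = 0 then δ else 1

/-- `diag(1, δ, …, δ)`. -/
def restDiagonal {F : Type*} [Field F] {m : ℕ} (δ : F) :
    Matrix (Fin (m + 2)) (Fin (m + 2)) F :=
  diagonal fun i => if i = 0 then 1 else δ

theorem firstDiagonal_mul_restDiagonal {F : Type*} [Field F] {m : ℕ} (δ : F) :
    (firstDiagonal δ * restDiagonal δ : Matrix (Fin (m + 2)) (Fin (m + 2)) F) = δ • 1 := by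
  rw [firstDiagonal, restDiagonal, diagonal_mul_diagonal, ← diagonal_one, ← diagonal_smul]
  congr 1
  ext i
  by_cases h : i = 0 <;> simp [h]

theorem det_firstDiagonal {F : Type*} [Field F] {m : ℕ} (δ : F) :
    (firstDiagonal δ : Matrix (Fin (m + 2)) (Fin (m + 2)) F).det = δ := by
  rw [firstDiagonal, det_diagonal, Finset.prod_ite_eq' Finset.univ 0]
  simp

/-- A polynomial substitute for conjugation: its value at `s * diag(δ, 1, …, 1)` with `det s = 1`
is `δ ^ 2 • (s g s⁻¹)`. -/
def polyConj {F : Type*} [Field F] {m : ℕ} (g M : Matrix (Fin (m + 2)) (Fin (m + 2)) F) :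
    Matrix (Fin (m + 2)) (Fin (m + 2)) F :=
  M * restDiagonal M.det * g * firstDiagonal M.det * M.adjugate

theorem polyConj_mul_firstDiagonal {F : Type*} [Field F] {m : ℕ} (δ : F)
    (g s : SpecialLinearGroup (Fin (m + 2)) F) :
    polyConj g.1 (s.1 * firstDiagonal δ) = δ ^ 2 • (s * g * s⁻¹).1 := by
  have hdet : (s.1 * firstDiagonal δ).det = δ := by
    rw [det_mul, s.2, one_mul, det_firstDiagonal]
  have hadj : firstDiagonal δ * (s.1 * firstDiagonal δ).adjugate = δ • (s⁻¹).1 := by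
    rw [adjugate_mul_distrib, ← mul_assoc, mul_adjugate, det_firstDiagonal, smul_mul_assoc,
      one_mul]
    rfl
  rw [polyConj, hdet, mul_assoc _ (firstDiagonal δ) (adjugate _), hadj, mul_assoc s.1,
    firstDiagonal_mul_restDiagonal]
  simp only [Matrix.SpecialLinearGroup.coe_mul, Matrix.mul_smul, Matrix.smul_mul, mul_one,
    smul_smul, pow_two]

theorem isPolynomialFunction_polyConj {F σ : Type*} [Field F] {m : ℕ}
    (g : Matrix (Fin (m + 2)) (Fin (m + 2)) F)
    {A : (σ → F) → Matrix (Fin (m + 2)) (Fin (m + 2)) F}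
    (hA : ∀ i j, IsPolynomialFunction 1 fun x => A x i j) (i j : Fin (m + 2)) :
    IsPolynomialFunction (3 * (m + 2) + 1) fun x => polyConj g (A x) i j := by
  have hdet := IsPolynomialFunction.matrix_det hA
  have hfirst : ∀ i j : Fin (m + 2), IsPolynomialFunction ((m + 2) * 1)
      fun x => firstDiagonal (A x).det i j := by
    intro i j
    simp only [firstDiagonal, diagonal_apply]
    split_ifs
    · exact hdet
    · exact IsPolynomialFunction.const _ _
    · exact IsPolynomialFunction.const _ _
  have hrest : ∀ i j : Fin (m + 2), IsPolynomialFunction ((m + 2) * 1)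
      fun x => restDiagonal (A x).det i j := by
    intro i j
    simp only [restDiagonal, diagonal_apply]
    split_ifs
    · exact IsPolynomialFunction.const _ _
    · exact hdet
    · exact IsPolynomialFunction.const _ _
  have h1 := IsPolynomialFunction.matrix_mul hA hrest
  have h2 := IsPolynomialFunction.matrix_mul (B := fun _ => g) (d' := 0) h1
    fun i j => IsPolynomialFunction.const 0 _
  have h3 := IsPolynomialFunction.matrix_mul h2 hfirst
  exact (IsPolynomialFunction.matrix_mul h3
    (IsPolynomialFunction.matrix_adjugate hA) i j).mono (by omega)

theorem list_ofFn_smul_prod {F : Type*} [Field F] {n k : ℕ} (c : Fin k → F)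
    (A : Fin k → Matrix (Fin n) (Fin n) F) :
    (List.ofFn fun i => c i • A i).prod = (∏ i, c i) • (List.ofFn A).prod := by
  induction k with
  | zero => simp
  | succ k ih =>
    rw [List.ofFn_succ, List.prod_cons, ih, List.ofFn_succ, List.prod_cons, Fin.prod_univ_succ,
      Matrix.smul_mul, Matrix.mul_smul, smul_smul]

theorem specialLinear_coe_list_ofFn_prod {F : Type*} [Field F] {n k : ℕ}
    (A : Fin k → SpecialLinearGroup (Fin n) F) :
    (List.ofFn A).prod.1 = (List.ofFn fun i => (A i).1).prod := by
  induction k with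
  | zero => simp
  | succ k ih =>
    rw [List.ofFn_succ, List.prod_cons, List.ofFn_succ, List.prod_cons, ← ih]
    rfl

theorem card_not_cyclic_conjWord_le {F : Type*} [Field F] [Fintype F] [DecidableEq F] {m k : ℕ}
    (g : SpecialLinearGroup (Fin (m + 2)) F)
    (hex : ∃ p : Fin k → SpecialLinearGroup (Fin (m + 2)) F × SpecialLinearGroup (Fin (m + 2)) F,
      krylovDet (conjWord g p).1 ≠ 0) :
    (Finset.univ.filter fun p : Fin k → SpecialLinearGroup (Fin (m + 2)) F ×
        SpecialLinearGroup (Fin (m + 2)) F => ¬ krylovDet (conjWord g p).1 ≠ 0).card *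
      (Fintype.card F - 1) ^ (2 * k) * Fintype.card F ≤
      (m + 2) * ((m + 2) * (k * (2 * (3 * (m + 2) + 1)))) *
        Fintype.card F ^ (2 * k * ((m + 2) * (m + 2))) := by
  set σ := (Fin k × Bool) × Fin (m + 2) × Fin (m + 2) with hσ
  let M : Fin k × Bool → (σ → F) → Matrix (Fin (m + 2)) (Fin (m + 2)) F :=
    fun e x => Matrix.of fun a b => x (e, a, b)
  let W : (σ → F) → Matrix (Fin (m + 2)) (Fin (m + 2)) F := fun x =>
    (List.ofFn fun i => polyConj g.1 (M (i, false) x) * polyConj (g⁻¹).1 (M (i, true) x)).prod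
  have hM : ∀ e i j, IsPolynomialFunction 1 fun x => M e x i j :=
    fun e i j => IsPolynomialFunction.coord _
  have hW : ∀ i j, IsPolynomialFunction (k * (2 * (3 * (m + 2) + 1))) fun x => W x i j := by
    intro i j
    refine IsPolynomialFunction.matrix_list_prod (fun l a b => ?_) i j
    exact (IsPolynomialFunction.matrix_mul (isPolynomialFunction_polyConj g.1 (hM (l, false)))
      (isPolynomialFunction_polyConj (g⁻¹).1 (hM (l, true))) a b).mono (by omega)
  let comp : (Fin k → SpecialLinearGroup (Fin (m + 2)) F × SpecialLinearGroup (Fin (m + 2)) F) → Fin k × Bool →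
      SpecialLinearGroup (Fin (m + 2)) F :=
    fun p e => bif e.2 then (p e.1).2 else (p e.1).1
  let pt : (Fin k × Bool → Fˣ) ×
      (Fin k → SpecialLinearGroup (Fin (m + 2)) F × SpecialLinearGroup (Fin (m + 2)) F) → σ → F :=
    fun y t => ((comp y.2 t.1).1 * firstDiagonal (y.1 t.1 : F) : Matrix (Fin (m + 2)) (Fin (m + 2)) F)
      t.2.1 t.2.2
  have hMpt : ∀ y e, M e (pt y) = (comp y.2 e).1 * firstDiagonal (y.1 e : F) := fun _ _ => rfl
  have hWpt : ∀ y, ∃ c : F, c ≠ 0 ∧ W (pt y) = c • (conjWord g y.2).1 := by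
    intro y
    refine ⟨∏ i, ((y.1 (i, false) : F) ^ 2 * (y.1 (i, true) : F) ^ 2), ?_, ?_⟩
    · exact Finset.prod_ne_zero_iff.mpr fun i _ => by simp
    · simp only [W]
      rw [conjWord, specialLinear_coe_list_ofFn_prod, ← list_ofFn_smul_prod]
      congr 2
      ext1 i
      rw [hMpt, hMpt, polyConj_mul_firstDiagonal, polyConj_mul_firstDiagonal, Matrix.smul_mul,
        Matrix.mul_smul, smul_smul]
      rfl
  have hKpt : ∀ y, krylovDet (W (pt y)) = 0 ↔ krylovDet (conjWord g y.2).1 = 0 := by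
    intro y
    obtain ⟨c, hc, h⟩ := hWpt y
    rw [h, krylovDet_smul, mul_eq_zero, or_iff_right]
    exact Finset.prod_ne_zero_iff.mpr fun i _ => pow_ne_zero _ hc
  have hinj : Function.Injective pt := by
    intro y z hyz
    have h1 : ∀ e, (comp y.2 e).1 * firstDiagonal (y.1 e : F) =
        (comp z.2 e).1 * firstDiagonal (z.1 e : F) := by
      intro e
      rw [← hMpt, ← hMpt, hyz]
    have h2 : ∀ e, y.1 e = z.1 e := by
      intro e
      have := congrArg Matrix.det (h1 e)
      rw [det_mul, det_mul, (comp y.2 e).2, (comp z.2 e).2, det_firstDiagonal,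
        det_firstDiagonal, one_mul, one_mul] at this
      exact Units.ext this
    have h3 : ∀ e, comp y.2 e = comp z.2 e := by
      intro e
      have h4 := congrArg (· * restDiagonal (y.1 e : F)) (h1 e)
      simp only [← h2 e, mul_assoc, firstDiagonal_mul_restDiagonal, Matrix.mul_smul, mul_one]
        at h4
      apply Subtype.ext
      exact smul_right_injective _ (Units.ne_zero (y.1 e)) h4
    refine Prod.ext (funext h2) (funext fun i => Prod.ext (h3 (i, false)) (h3 (i, true)))
  have hcount := (isPolynomialFunction_krylovDet hW).card_zeros_le (by
    obtain ⟨p, hp⟩ := hex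
    exact ⟨pt (1, p), fun h => hp ((hKpt (1, p)).mp h)⟩)
  have hcard : Fintype.card σ = 2 * k * ((m + 2) * (m + 2)) := by
    simp [hσ, mul_comm]
  rw [hcard] at hcount
  refine le_trans (Nat.mul_le_mul_right _ ?_) hcount
  have hB : (Finset.univ.filter fun p :
        Fin k → SpecialLinearGroup (Fin (m + 2)) F × SpecialLinearGroup (Fin (m + 2)) F =>
      ¬ krylovDet (conjWord g p).1 ≠ 0).card * (Fintype.card F - 1) ^ (2 * k) =
      ((Finset.univ : Finset (Fin k × Bool → Fˣ)) ×ˢ (Finset.univ.filter fun p :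
        Fin k → SpecialLinearGroup (Fin (m + 2)) F × SpecialLinearGroup (Fin (m + 2)) F =>
        ¬ krylovDet (conjWord g p).1 ≠ 0)).card := by
    rw [Finset.card_product, Finset.card_univ, Fintype.card_fun, Fintype.card_units, mul_comm]
    simp [mul_comm]
  rw [hB]
  refine Finset.card_le_card_of_injOn pt ?_ hinj.injOn
  intro y hy
  have hy' := (Finset.mem_filter.mp (Finset.mem_product.mp (Finset.mem_coe.mp hy)).2).2
  simp only [Finset.coe_filter, Finset.mem_univ, true_and, Set.mem_ofPred_eq]
  exact (hKpt y).mpr (not_not.mp hy')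

theorem pow_le_card_specialLinear {F : Type*} [Field F] [Fintype F] [DecidableEq F] {m : ℕ}
    (hq : 2 * (m + 2) ≤ Fintype.card F) :
    Fintype.card F ^ ((m + 2) * (m + 2)) ≤
      2 * ((Fintype.card F - 1) * Fintype.card (SpecialLinearGroup (Fin (m + 2)) F)) := by
  set q := Fintype.card F with hqd
  have hpoly : IsPolynomialFunction ((m + 2) * 1) fun x : Fin (m + 2) × Fin (m + 2) → F =>
      (Matrix.of fun a b => x (a, b)).det :=
    IsPolynomialFunction.matrix_det fun i j => IsPolynomialFunction.coord _
  have hcount := hpoly.card_zeros_le ⟨fun t => (1 : Matrix (Fin (m + 2)) (Fin (m + 2)) F) t.1 t.2,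
    by
      have : (Matrix.of fun a b => (1 : Matrix (Fin (m + 2)) (Fin (m + 2)) F) a b) = 1 := rfl
      rw [this, det_one]
      exact one_ne_zero⟩
  have hcard : Fintype.card (Fin (m + 2) × Fin (m + 2)) = (m + 2) * (m + 2) := by simp
  rw [hcard, mul_one, ← hqd] at hcount
  have hsplit := Finset.card_filter_add_card_filter_not (s := (Finset.univ :
    Finset (Fin (m + 2) × Fin (m + 2) → F))) (fun x => (Matrix.of fun a b => x (a, b)).det = 0)
  rw [Finset.card_univ, Fintype.card_fun, hcard, ← hqd] at hsplit
  have hinj : (Finset.univ.filter fun x : Fin (m + 2) × Fin (m + 2) → F =>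
      ¬ (Matrix.of fun a b => x (a, b)).det = 0).card ≤
      (q - 1) * Fintype.card (SpecialLinearGroup (Fin (m + 2)) F) := by
    rw [hqd, ← Fintype.card_units, ← Fintype.card_prod, ← Finset.card_univ]
    refine Finset.card_le_card_of_surjOn (fun (y : Fˣ × SpecialLinearGroup (Fin (m + 2)) F) t =>
      (y.2.1 * firstDiagonal (y.1 : F) : Matrix (Fin (m + 2)) (Fin (m + 2)) F) t.1 t.2) ?_
    intro x hx
    have hx' := (Finset.mem_filter.mp (Finset.mem_coe.mp hx)).2
    set X : Matrix (Fin (m + 2)) (Fin (m + 2)) F := Matrix.of fun a b => x (a, b) with hX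
    refine ⟨(Units.mk0 X.det hx', ⟨X * firstDiagonal X.det⁻¹, by
      rw [det_mul, det_firstDiagonal, mul_inv_cancel₀ hx']⟩), by simp, ?_⟩
    ext t
    have h1 : (firstDiagonal X.det⁻¹ * firstDiagonal X.det :
        Matrix (Fin (m + 2)) (Fin (m + 2)) F) = 1 := by
      rw [firstDiagonal, firstDiagonal, diagonal_mul_diagonal, ← diagonal_one]
      congr 1
      ext i
      by_cases h : i = 0 <;> simp [h, inv_mul_cancel₀ hx']
    simp only [Units.val_mk0, mul_assoc, h1, mul_one]
    rfl
  set Z := (Finset.univ.filter fun x : Fin (m + 2) × Fin (m + 2) → F =>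
      (Matrix.of fun a b => x (a, b)).det = 0).card with hZ
  have hZ2 : 2 * Z ≤ q ^ ((m + 2) * (m + 2)) := by
    have h1 : (m + 2) * (2 * Z) ≤ (m + 2) * q ^ ((m + 2) * (m + 2)) := by
      calc (m + 2) * (2 * Z) = Z * (2 * (m + 2)) := by ring
        _ ≤ Z * q := Nat.mul_le_mul_left _ hq
        _ ≤ _ := hcount
    exact Nat.le_of_mul_le_mul_left h1 (by omega)
  omega

theorem specialLinear_inv_mulVec_mulVec {F : Type*} [Field F] {n : ℕ}
    (s : SpecialLinearGroup (Fin n) F) (x : Fin n → F) : (s⁻¹).1 *ᵥ (s.1 *ᵥ x) = x := by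
  rw [mulVec_mulVec, ← Matrix.SpecialLinearGroup.coe_mul, inv_mul_cancel,
    Matrix.SpecialLinearGroup.coe_one, one_mulVec]

theorem specialLinear_mul_mulVec {F : Type*} [Field F] {n : ℕ}
    (s t : SpecialLinearGroup (Fin n) F) (x : Fin n → F) :
    (s * t).1 *ᵥ x = s.1 *ᵥ (t.1 *ᵥ x) := by
  rw [mulVec_mulVec]; rfl

theorem linearIndependent_specialLinear_mulVec {F ι : Type*} [Field F] {n : ℕ}
    (s : SpecialLinearGroup (Fin n) F) (v : ι → Fin n → F) (hv : LinearIndependent F v) :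
    LinearIndependent F fun i => s.1 *ᵥ v i := by
  refine hv.map' (Matrix.mulVecLin s.1) (LinearMap.ker_eq_bot.mpr ?_)
  intro x y hxy
  have := congrArg ((s⁻¹).1 *ᵥ ·) hxy
  simpa only [mulVecLin_apply, specialLinear_inv_mulVec_mulVec] using this

/-- Two functionals that separate the last vector of an independent family from the others. -/
theorem exists_dual_pair {F : Type*} [Field F] {m k : ℕ} (hk : k < m + 1)
    (b : Fin (k + 1) → Fin (m + 2) → F) (hb : LinearIndependent F b) :
    ∃ φ φ' : Fin (m + 2) → F, LinearIndependent F ![φ, φ'] ∧ (∀ i, φ ⬝ᵥ b i = 0) ∧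
      (∀ i : Fin k, φ' ⬝ᵥ b i.castSucc = 0) ∧ φ' ⬝ᵥ b (Fin.last k) = 1 := by
  obtain ⟨s, hs⟩ := exists_specialLinear_rows (by omega : k + 1 < m + 2) b hb
  let ξ : Fin (m + 2) → Fin (m + 2) → F := fun i l => (s⁻¹).1 l i
  have hξ : ∀ i j, ξ i ⬝ᵥ s.1 j = if j = i then 1 else 0 := by
    intro i j
    have h : (s.1 * (s⁻¹).1) j i = (1 : Matrix (Fin (m + 2)) (Fin (m + 2)) F) j i := by
      rw [← Matrix.SpecialLinearGroup.coe_mul, mul_inv_cancel, Matrix.SpecialLinearGroup.coe_one]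
    rw [Matrix.one_apply, Matrix.mul_apply] at h
    rw [← h, dotProduct]
    exact Finset.sum_congr rfl fun l _ => mul_comm _ _
  have hne : Fin.last (m + 1) ≠ (Fin.castLE (by omega) (Fin.last k) : Fin (m + 2)) := by
    intro h
    have := congrArg Fin.val h
    simp at this
    omega
  refine ⟨ξ (Fin.last (m + 1)), ξ (Fin.castLE (by omega) (Fin.last k)), ?_, ?_, ?_, ?_⟩
  · rw [LinearIndependent.pair_iff]
    intro x y hxy
    have h1 := congrArg (· ⬝ᵥ s.1 (Fin.last (m + 1))) hxy
    have h2 := congrArg (· ⬝ᵥ s.1 (Fin.castLE (by omega) (Fin.last k))) hxy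
    simp only [add_dotProduct, smul_dotProduct, hξ, zero_dotProduct, smul_eq_mul] at h1 h2
    simp only [hne, hne.symm, if_true, if_false, mul_one, mul_zero, add_zero, zero_add] at h1 h2
    exact ⟨h1, h2⟩
  · intro i
    rw [← hs i, hξ, if_neg]
    intro h
    have := congrArg Fin.val h
    simp at this
    omega
  · intro i
    rw [← hs, hξ, if_neg]
    intro h
    have := congrArg Fin.val h
    simp at this
    omega
  · rw [← hs, hξ, if_pos rfl]

theorem exists_conj_mul_conj_inv {F : Type*} [Field F] {m k : ℕ} (hk : k < m + 1)
    (g : SpecialLinearGroup (Fin (m + 2)) F)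
    (hg : ∃ φ : Fin (m + 2) → F, LinearIndependent F ![φ, φ ᵥ* (g⁻¹).1])
    (b v : Fin (k + 1) → Fin (m + 2) → F) (hb : LinearIndependent F b)
    (hv : LinearIndependent F v) :
    ∃ a : SpecialLinearGroup (Fin (m + 2)) F × SpecialLinearGroup (Fin (m + 2)) F,
      (∀ i : Fin k, (a.1 * g * a.1⁻¹ * (a.2 * g⁻¹ * a.2⁻¹)).1 *ᵥ b i.castSucc = b i.castSucc) ∧
      LinearIndependent F (Fin.snoc v ((a.1 * g * a.1⁻¹ * (a.2 * g⁻¹ * a.2⁻¹)).1 *ᵥ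
        b (Fin.last k)) : Fin (k + 1 + 1) → Fin (m + 2) → F) := by
  obtain ⟨φ₀, hφ₀⟩ := hg
  obtain ⟨φ, φ', hφφ', hφ, hφ'0, hφ'1⟩ := exists_dual_pair hk b hb
  obtain ⟨s, c, hc, -, hs1, hs2⟩ := exists_specialLinear_vecMul _ _ _ _ hφ₀ hφφ'
  set y := b (Fin.last k) with hy
  obtain ⟨z, hz1, hz2⟩ : ∃ z, φ' ⬝ᵥ z = 1 ∧
      LinearIndependent F (Fin.snoc v z : Fin (k + 1 + 1) → Fin (m + 2) → F) := by
    obtain ⟨z₀, hz₀⟩ := exists_linearIndependent_snoc_of_lt_finrank hv (by simp; omega)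
    rw [linearIndependent_finSnoc] at hz₀
    by_cases hmem : y ∈ Submodule.span F (Set.range v)
    · refine ⟨z₀ + (1 - φ' ⬝ᵥ z₀) • y, ?_, ?_⟩
      · rw [dotProduct_add, dotProduct_smul, hφ'1]
        simp
      · rw [linearIndependent_finSnoc]
        refine ⟨hv, fun h => hz₀.2 ?_⟩
        have := Submodule.sub_mem _ h (Submodule.smul_mem _ (1 - φ' ⬝ᵥ z₀) hmem)
        simpa using this
    · exact ⟨y, hφ'1, by rw [linearIndependent_finSnoc]; exact ⟨hv, hmem⟩⟩
  set g₁ := s⁻¹ * g * s with hg₁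
  have hφg : φ ᵥ* (g₁⁻¹).1 = c • φ' := by
    rw [← hs2, ← hs1, vecMul_vecMul, vecMul_vecMul, ← Matrix.SpecialLinearGroup.coe_mul,
      ← Matrix.SpecialLinearGroup.coe_mul]
    have : s * g₁⁻¹ = g⁻¹ * s := by simp [hg₁, mul_assoc]
    rw [this]
  set u' := c⁻¹ • (z - y) with hu'
  set u := (g₁⁻¹).1 *ᵥ u' with hu
  have hφu : φ ⬝ᵥ u = 0 := by
    rw [hu, dotProduct_mulVec, hφg, hu', smul_dotProduct, dotProduct_smul, dotProduct_sub, hz1,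
      hφ'1]
    simp
  have hg₁u : g₁.1 *ᵥ u = u' := by
    have := specialLinear_inv_mulVec_mulVec g₁⁻¹ u'
    rwa [inv_inv] at this
  set t := rankOneTransvection u φ hφu with ht
  have htx : ∀ x, t.1 *ᵥ x = x + (φ ⬝ᵥ x) • u := by
    intro x
    rw [ht, coe_rankOneTransvection, add_mulVec, one_mulVec, vecMulVec_mulVec]
    simp
  have htinv : ∀ x, φ ⬝ᵥ x = 0 → (t⁻¹).1 *ᵥ x = x := by
    intro x hx
    have h1 : t.1 *ᵥ x = x := by rw [htx, hx]; simp
    conv_lhs => rw [← h1]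
    exact specialLinear_inv_mulVec_mulVec t x
  have hr : ∀ x, φ ⬝ᵥ x = 0 → (s⁻¹ * g * s⁻¹⁻¹ * (t * s⁻¹ * g⁻¹ * (t * s⁻¹)⁻¹)).1 *ᵥ x =
      x + (c * (φ' ⬝ᵥ x)) • u' := by
    intro x hx
    have h1 : s⁻¹ * g * s⁻¹⁻¹ * (t * s⁻¹ * g⁻¹ * (t * s⁻¹)⁻¹) = g₁ * t * g₁⁻¹ * t⁻¹ := by
      rw [hg₁]; group
    rw [h1, specialLinear_mul_mulVec, htinv x hx, specialLinear_mul_mulVec,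
      specialLinear_mul_mulVec, htx, mulVec_add, mulVec_smul, hg₁u, dotProduct_mulVec, hφg,
      smul_dotProduct, smul_eq_mul]
    have := specialLinear_inv_mulVec_mulVec g₁⁻¹ x
    rw [inv_inv] at this
    rw [this]
  refine ⟨(s⁻¹, t * s⁻¹), fun i => ?_, ?_⟩
  · rw [hr _ (hφ _), hφ'0]; simp
  · rw [hr _ (hφ _), hφ'1, mul_one, hu', smul_smul, mul_inv_cancel₀ hc, one_smul,
      add_sub_cancel]
    exact hz2

theorem exists_conjWord_linearIndependent {F : Type*} [Field F] {m : ℕ}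
    (g : SpecialLinearGroup (Fin (m + 2)) F)
    (hg : ∃ φ : Fin (m + 2) → F, LinearIndependent F ![φ, φ ᵥ* (g⁻¹).1]) (k : ℕ)
    (hk : k ≤ m + 1) :
    ∃ p : Fin k → SpecialLinearGroup (Fin (m + 2)) F × SpecialLinearGroup (Fin (m + 2)) F,
      LinearIndependent F fun i : Fin (k + 1) =>
        ((conjWord g p ^ (i : ℕ)).1 *ᵥ Pi.single 0 1 : Fin (m + 2) → F) := by
  induction k with
  | zero =>
    refine ⟨fun i => i.elim0, ?_⟩
    refine (linearIndependent_unique_iff (ι := Fin 1)).mpr fun h => ?_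
    have := congrFun h 0
    simp at this
  | succ k ih =>
    obtain ⟨p, hp⟩ := ih (by omega)
    set w := conjWord g p with hw
    have hb := linearIndependent_specialLinear_mulVec w _ hp
    obtain ⟨a, ha1, ha2⟩ := exists_conj_mul_conj_inv (by omega) g hg _ _ hb hp
    refine ⟨Fin.cons a p, ?_⟩
    rw [conjWord_cons, ← hw]
    set r := a.1 * g * a.1⁻¹ * (a.2 * g⁻¹ * a.2⁻¹)
    clear_value r
    have hpow : ∀ i : ℕ, i ≤ k → ((r * w) ^ i).1 *ᵥ (Pi.single 0 1 : Fin (m + 2) → F) =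
        (w ^ i).1 *ᵥ Pi.single 0 1 := by
      intro i
      induction i with
      | zero => intro _; simp
      | succ i ihi =>
        intro hi
        rw [pow_succ', specialLinear_mul_mulVec, ihi (by omega), specialLinear_mul_mulVec r,
          pow_succ' w, specialLinear_mul_mulVec w]
        exact ha1 ⟨i, by omega⟩
    convert ha2 using 1
    ext1 i
    refine Fin.lastCases ?_ (fun i => ?_) i
    · rw [Fin.snoc_last, Fin.val_last, pow_succ', specialLinear_mul_mulVec, hpow k le_rfl,
        specialLinear_mul_mulVec r]
      rfl
    · rw [Fin.snoc_castSucc, Fin.val_castSucc, hpow i (by omega)]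

theorem exists_conjWord_krylovDet_ne_zero {F : Type*} [Field F] {m : ℕ}
    (g : SpecialLinearGroup (Fin (m + 2)) F)
    (hg : ∃ φ : Fin (m + 2) → F, LinearIndependent F ![φ, φ ᵥ* (g⁻¹).1]) (k : ℕ)
    (hk : m + 1 ≤ k) :
    ∃ p : Fin k → SpecialLinearGroup (Fin (m + 2)) F × SpecialLinearGroup (Fin (m + 2)) F,
      krylovDet (conjWord g p).1 ≠ 0 := by
  induction k, hk using Nat.le_induction with
  | base =>
    obtain ⟨p, hp⟩ := exists_conjWord_linearIndependent g hg (m + 1) le_rfl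
    refine ⟨p, ?_⟩
    have hcol : (Matrix.of fun i j : Fin (m + 2) => ((conjWord g p).1 ^ (j : ℕ)) i 0).col =
        fun i : Fin (m + 1 + 1) =>
          ((conjWord g p ^ (i : ℕ)).1 *ᵥ Pi.single 0 1 : Fin (m + 2) → F) := by
      ext j i
      have h1 := Matrix.SpecialLinearGroup.coe_pow (conjWord g p) j
      rw [mulVec_single_one]
      exact (congrFun (congrFun h1 i) 0).symm
    rw [← hcol, linearIndependent_cols_iff_isUnit] at hp
    exact ((Matrix.isUnit_iff_isUnit_det _).mp hp).ne_zero
  | succ k _ ih =>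
    obtain ⟨p, hp⟩ := ih
    refine ⟨Fin.cons (1, 1) p, ?_⟩
    rw [conjWord_cons]
    simpa using hp

theorem exists_linearIndependent_vecMul {F : Type*} [Field F] {n : ℕ}
    (g : SpecialLinearGroup (Fin n) F) (hg : g ∉ Subgroup.center (SpecialLinearGroup (Fin n) F)) :
    ∃ φ : Fin n → F, LinearIndependent F ![φ, φ ᵥ* g.1] := by
  by_contra hcon
  push Not at hcon
  have heig : ∀ φ : Fin n → F, φ ≠ 0 → ∃ a : F, φ ᵥ* g.1 = a • φ := by
    intro φ hφ
    have h := hcon φ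
    rw [LinearIndependent.pair_iff' hφ] at h
    push Not at h
    obtain ⟨a, ha⟩ := h
    exact ⟨a, ha.symm⟩
  apply hg
  rw [Subgroup.mem_center_iff]
  intro h
  have hscalar : ∃ a : F, g.1 = a • (1 : Matrix (Fin n) (Fin n) F) := by
    have h1 : ∀ i, ∃ a : F, g.1 i = a • Pi.single i 1 := by
      intro i
      obtain ⟨a, ha⟩ := heig (Pi.single i 1) (by simp)
      rw [single_one_vecMul] at ha
      exact ⟨a, ha⟩
    choose a ha using h1
    have h2 : ∀ i j, a i = a j := by
      intro i j
      by_cases hij : i = j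
      · rw [hij]
      obtain ⟨c, hc⟩ := heig (Pi.single i 1 + Pi.single j 1) (by
        intro h0
        have := congrFun h0 i
        simp [hij] at this)
      rw [add_vecMul, single_one_vecMul, single_one_vecMul] at hc
      have hc' : g.1 i + g.1 j = c • (Pi.single i 1 + Pi.single j 1) := hc
      rw [ha, ha] at hc'
      have h3 := congrFun hc' i
      have h4 := congrFun hc' j
      simp [hij, Ne.symm hij] at h3 h4
      rw [h3, h4]
    rcases isEmpty_or_nonempty (Fin n) with hn | ⟨⟨i₀⟩⟩
    · exact ⟨0, Subsingleton.elim _ _⟩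
    · refine ⟨a i₀, ?_⟩
      ext i j
      rw [ha i, h2 i i₀, Matrix.smul_apply, Pi.smul_apply, Matrix.one_apply, Pi.single_apply]
      simp [eq_comm]
  obtain ⟨a, ha⟩ := hscalar
  apply Subtype.ext
  rw [Matrix.SpecialLinearGroup.coe_mul, Matrix.SpecialLinearGroup.coe_mul, ha]
  simp

/-- Uniform decay of the correlations of class functions on `SL_n(F)` under noncentral
translations. -/
theorem exists_specialLinear_correlation_bound (m : ℕ) :
    ∃ C : ℝ, 0 < C ∧ ∀ (F : Type) [Field F] [Fintype F] [DecidableEq F],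
      2 * (m + 2) ≤ Fintype.card F →
      ∀ g : SpecialLinearGroup (Fin (m + 2)) F, g ∉ Subgroup.center _ →
      ∀ f₁ f₂ : SpecialLinearGroup (Fin (m + 2)) F → ℝ,
        (∀ h x, f₁ (h * x * h⁻¹) = f₁ x) → (∀ h x, f₂ (h * x * h⁻¹) = f₂ x) →
        ∑ x, f₁ x = 0 →
        ((∑ x, f₁ (g * x) * f₂ x) ^ 2) ^ 2 ^ (m + 1) ≤
          C / √(Fintype.card F) * (∑ x, f₁ x ^ 2) ^ 2 ^ (m + 1) *
            (∑ x, f₂ x ^ 2) ^ 2 ^ (m + 1) := by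
  classical
  set N := 2 ^ (m + 1) with hN
  set D : ℕ := (m + 2) * ((m + 2) * (N * (2 * (3 * (m + 2) + 1)))) with hD
  set C₁ : ℝ := 64 * 2 ^ (2 * (m + 2)) * (m + 2) with hC₁
  have hC₁0 : 0 < C₁ := by positivity
  refine ⟨D * 4 ^ N + √C₁, by positivity, ?_⟩
  intro F _ _ _ hq g hg f₁ f₂ hf₁ hf₂ hf₀
  set q := Fintype.card F with hqd
  have hq1 : 1 < q := Fintype.one_lt_card
  have hq0 : (0 : ℝ) < q := by exact_mod_cast (by omega : 0 < q)
  have hq1' : (1 : ℝ) ≤ q := by exact_mod_cast hq1.le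
  have hsq : (0 : ℝ) < √q := Real.sqrt_pos.mpr hq0
  set S : ℝ := ∑ x, f₁ x ^ 2 with hS
  have hS0 : 0 ≤ S := Finset.sum_nonneg fun _ _ => sq_nonneg _
  have hη : ∀ w : SpecialLinearGroup (Fin (m + 2)) F, krylovDet w.1 ≠ 0 →
      |∑ x, f₁ (w * x) * f₁ x| ≤ √C₁ / √q * S := by
    intro w hw
    have h1 := specialLinear_correlation_le f₁ hf₁ hf₀ w
    have h2 := card_centralizer_le w hw
    set c := (Finset.univ.filter fun h : SpecialLinearGroup (Fin (m + 2)) F =>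
      h * w = w * h).card
    rw [← hqd] at h1 h2
    have h3 : (c : ℝ) * q ≤ (m + 2) * (q : ℝ) ^ (m + 2) := by exact_mod_cast h2
    have h4 : (c : ℝ) ≤ (m + 2) * (q : ℝ) ^ (m + 1) := by
      rw [pow_succ, ← mul_assoc] at h3
      exact le_of_mul_le_mul_right h3 hq0
    have hQ : (q : ℝ) ≤ (q : ℝ) ^ (m + 1) := le_self_pow₀ hq1' (by omega)
    set Q := (q : ℝ) ^ (m + 1) with hQd
    have hQ0 : 0 < Q := by positivity
    set X := ∑ x, f₁ (w * x) * f₁ x with hX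
    have h5 : X ^ 2 * Q ^ 2 ≤ C₁ * Q * S ^ 2 := by
      refine h1.trans ?_
      rw [hC₁]
      have := mul_le_mul_of_nonneg_left h4 (by positivity : (0 : ℝ) ≤
        64 * 2 ^ (2 * (m + 2)) * S ^ 2)
      nlinarith [this]
    have h6 : X ^ 2 * Q ≤ C₁ * S ^ 2 := by
      refine le_of_mul_le_mul_right ?_ hQ0
      nlinarith [h5]
    have h7 : X ^ 2 * q ≤ C₁ * S ^ 2 :=
      (mul_le_mul_of_nonneg_left hQ (sq_nonneg X)).trans h6
    have h8 : X ^ 2 ≤ (√C₁ / √q * S) ^ 2 := by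
      rw [mul_pow, div_pow, Real.sq_sqrt hC₁0.le, Real.sq_sqrt hq0.le, div_mul_eq_mul_div,
        le_div_iff₀ hq0]
      exact h7
    exact abs_le_of_sq_le_sq h8 (by positivity)
  have hex := exists_conjWord_krylovDet_ne_zero (k := N) g
    (exists_linearIndependent_vecMul g⁻¹ (fun h => hg (by
      have := Subgroup.inv_mem _ h
      rwa [inv_inv] at this))) (Nat.lt_two_pow_self).le
  have hbad := card_not_cyclic_conjWord_le g hex
  set B := (Finset.univ.filter fun p : Fin N → SpecialLinearGroup (Fin (m + 2)) F ×
    SpecialLinearGroup (Fin (m + 2)) F => ¬ krylovDet (conjWord g p).1 ≠ 0).card with hB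
  have hsl := pow_le_card_specialLinear (F := F) (m := m) hq
  rw [← hqd] at hbad hsl
  have hbad2 : B * q ≤ D * (4 ^ N * Fintype.card (SpecialLinearGroup (Fin (m + 2)) F ×
      SpecialLinearGroup (Fin (m + 2)) F) ^ N) := by
    have hpos : 0 < (q - 1) ^ (2 * N) := pow_pos (by omega) _
    refine Nat.le_of_mul_le_mul_right ?_ hpos
    calc B * q * (q - 1) ^ (2 * N) = B * (q - 1) ^ (2 * N) * q := by ring
      _ ≤ D * q ^ (2 * N * ((m + 2) * (m + 2))) := hbad
      _ = D * (q ^ ((m + 2) * (m + 2))) ^ (2 * N) := by rw [← pow_mul]; ring_nf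
      _ ≤ D * (2 * ((q - 1) * Fintype.card (SpecialLinearGroup (Fin (m + 2)) F))) ^ (2 * N) :=
        Nat.mul_le_mul_left _ (Nat.pow_le_pow_left hsl _)
      _ = _ := by
        rw [Fintype.card_prod, mul_pow, mul_pow, pow_mul 2 2 N, ← pow_two,
          ← pow_mul (Fintype.card (SpecialLinearGroup (Fin (m + 2)) F)) 2 N]
        norm_num
        ring
  have hβ : (B : ℝ) ≤ D * 4 ^ N / √q * (Fintype.card (SpecialLinearGroup (Fin (m + 2)) F ×
      SpecialLinearGroup (Fin (m + 2)) F) : ℝ) ^ N := by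
    have h1 : (B : ℝ) * q ≤ D * (4 ^ N * (Fintype.card (SpecialLinearGroup (Fin (m + 2)) F ×
      SpecialLinearGroup (Fin (m + 2)) F) : ℝ) ^ N) := by exact_mod_cast hbad2
    have h2 : √(q : ℝ) ≤ q := by
      rw [Real.sqrt_le_left hq0.le]
      nlinarith
    rw [div_mul_eq_mul_div, le_div_iff₀ hsq, mul_assoc]
    exact (mul_le_mul_of_nonneg_left h2 (Nat.cast_nonneg B)).trans h1
  have key := correlation_pow_le g f₁ f₂ hf₁ hf₂ (m + 1) (fun w => krylovDet w.1 ≠ 0)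
    (√C₁ / √q) (D * 4 ^ N / √q) hη (by positivity) hβ
  rw [← add_div] at key
  exact key

theorem rankOneTransvection_mulVec {F : Type*} [Field F] {n : ℕ} (u φ : Fin n → F)
    (h : φ ⬝ᵥ u = 0) (x : Fin n → F) :
    (rankOneTransvection u φ h).1 *ᵥ x = x + (φ ⬝ᵥ x) • u := by
  rw [coe_rankOneTransvection, add_mulVec, one_mulVec, vecMulVec_mulVec]
  simp

theorem specialLinear_ext_mulVec {F : Type*} [Field F] {n : ℕ}
    {s t : SpecialLinearGroup (Fin n) F} (h : ∀ x, s.1 *ᵥ x = t.1 *ᵥ x) : s = t := by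
  apply Subtype.ext
  ext i j
  have := congrFun (h (Pi.single j 1)) i
  rwa [mulVec_single_one, mulVec_single_one] at this

theorem rankOneTransvection_inv_mulVec {F : Type*} [Field F] {n : ℕ} (u φ : Fin n → F)
    (h : φ ⬝ᵥ u = 0) (x : Fin n → F) :
    ((rankOneTransvection u φ h)⁻¹).1 *ᵥ x = x - (φ ⬝ᵥ x) • u := by
  have h1 : (rankOneTransvection u φ h).1 *ᵥ (x - (φ ⬝ᵥ x) • u) = x := by
    rw [rankOneTransvection_mulVec, dotProduct_sub, dotProduct_smul, h]
    simp
  conv_lhs => rw [← h1]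
  exact specialLinear_inv_mulVec_mulVec _ _

theorem exists_rankOneTransvection_mem_of_normal {F : Type*} [Field F] {m : ℕ} (hm : 1 ≤ m)
    (H : Subgroup (SpecialLinearGroup (Fin (m + 2)) F)) [hH : H.Normal]
    (g : SpecialLinearGroup (Fin (m + 2)) F) (hgH : g ∈ H) (hg : g ∉ Subgroup.center _) :
    ∃ u φ h, u ≠ 0 ∧ φ ≠ 0 ∧ rankOneTransvection u φ h ∈ H := by
  obtain ⟨φ, hφ⟩ := exists_linearIndependent_vecMul g⁻¹ (fun h => hg (by
    have := Subgroup.inv_mem _ h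
    rwa [inv_inv] at this))
  have hker : ∀ f : (Fin (m + 2) → F) →ₗ[F] (Fin 2 → F), ∃ x, x ≠ 0 ∧ f x = 0 := by
    intro f
    have : LinearMap.ker f ≠ ⊥ := LinearMap.ker_ne_bot_of_finrank_lt (by simp; omega)
    obtain ⟨x, hx, hx0⟩ := Submodule.exists_mem_ne_zero_of_ne_bot this
    exact ⟨x, hx0, hx⟩
  have hann : ∀ a b : Fin (m + 2) → F, ∃ x : Fin (m + 2) → F, x ≠ 0 ∧ a ⬝ᵥ x = 0 ∧ b ⬝ᵥ x = 0 := by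
    intro a b
    obtain ⟨x, hx0, hx⟩ := hker (Matrix.mulVecLin (Matrix.of ![a, b]))
    exact ⟨x, hx0, congrFun hx 0, congrFun hx 1⟩
  obtain ⟨u, hu0, hφu, -⟩ := hann φ φ
  set t := rankOneTransvection u φ hφu with ht
  set h := g * (t * g⁻¹ * t⁻¹) with hh
  have hhH : h ∈ H := H.mul_mem hgH (hH.conj_mem _ (H.inv_mem hgH) t)
  have hhx : ∀ x, h.1 *ᵥ x = x - (φ ⬝ᵥ x) • u +
      ((φ ᵥ* (g⁻¹).1) ⬝ᵥ (x - (φ ⬝ᵥ x) • u)) • (g.1 *ᵥ u) := by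
    intro x
    have := specialLinear_inv_mulVec_mulVec g⁻¹ (x - (φ ⬝ᵥ x) • u)
    rw [inv_inv] at this
    rw [hh, specialLinear_mul_mulVec, specialLinear_mul_mulVec, specialLinear_mul_mulVec, ht,
      rankOneTransvection_inv_mulVec, rankOneTransvection_mulVec, mulVec_add, mulVec_smul,
      dotProduct_mulVec, this]
  have hh1 : h ≠ 1 := by
    intro h1
    have hgu0 : g.1 *ᵥ u ≠ 0 := by
      intro h0
      have := specialLinear_inv_mulVec_mulVec g u
      rw [h0, mulVec_zero] at this
      exact hu0 this.symm
    have h2 : ∀ y, ((φ ᵥ* (g⁻¹).1) ⬝ᵥ y) • (g.1 *ᵥ u) = (φ ⬝ᵥ y) • u := by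
      intro y
      have h3 := hhx (y + (φ ⬝ᵥ y) • u)
      rw [h1, Matrix.SpecialLinearGroup.coe_one, one_mulVec, dotProduct_add, dotProduct_smul, hφu,
        smul_zero, add_zero, add_sub_cancel_right] at h3
      exact (add_left_cancel h3).symm
    obtain ⟨i, hi⟩ := Function.ne_iff.mp hgu0
    rw [LinearIndependent.pair_iff] at hφ
    have h4 := hφ (u i) (-(g.1 *ᵥ u) i) (by
      ext j
      have h5 := congrFun (h2 (Pi.single j 1)) i
      rw [dotProduct_single_one, dotProduct_single_one] at h5
      simp only [Pi.smul_apply, smul_eq_mul] at h5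
      simp only [Pi.add_apply, Pi.smul_apply, smul_eq_mul, Pi.zero_apply]
      linear_combination -h5)
    exact hi (neg_eq_zero.mp h4.2)
  clear_value h t
  obtain ⟨ψ, hψ0, hψu, hψgu⟩ := hann u (g.1 *ᵥ u)
  rw [dotProduct_comm] at hψu hψgu
  have hψh : ∀ x, ψ ⬝ᵥ (h.1 *ᵥ x) = ψ ⬝ᵥ x := by
    intro x
    rw [hhx, dotProduct_add, dotProduct_smul, hψgu, dotProduct_sub, dotProduct_smul, hψu]
    simp
  by_cases hfix : ∀ w, ψ ⬝ᵥ w = 0 → h.1 *ᵥ w = w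
  · obtain ⟨i, hi⟩ := Function.ne_iff.mp hψ0
    set e : Fin (m + 2) → F := Pi.single i (ψ i)⁻¹ with he
    have hψe : ψ ⬝ᵥ e = 1 := by
      rw [he, dotProduct_single, mul_inv_cancel₀ hi]
    have hform : h = rankOneTransvection (h.1 *ᵥ e - e) ψ
        (by rw [dotProduct_sub, hψh, sub_self]) := by
      refine specialLinear_ext_mulVec fun x => ?_
      rw [rankOneTransvection_mulVec]
      have h1 := hfix (x - (ψ ⬝ᵥ x) • e) (by rw [dotProduct_sub, dotProduct_smul, hψe]; simp)
      rw [mulVec_sub, mulVec_smul] at h1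
      rw [smul_sub]
      linear_combination (exp := 1) h1
    refine ⟨_, _, _, ?_, hψ0, hform ▸ hhH⟩
    intro h0
    apply hh1
    rw [hform]
    refine specialLinear_ext_mulVec fun x => ?_
    rw [rankOneTransvection_mulVec, h0]
    simp
  · push Not at hfix
    obtain ⟨w, hψw, hw⟩ := hfix
    set s := rankOneTransvection w ψ hψw with hs
    have hform : h * (s * h⁻¹ * s⁻¹) = rankOneTransvection (h.1 *ᵥ w - w) ψ
        (by rw [dotProduct_sub, hψh, sub_self]) := by
      refine specialLinear_ext_mulVec fun x => ?_
      have h2 : ∀ x, ψ ⬝ᵥ ((h⁻¹).1 *ᵥ x) = ψ ⬝ᵥ x := by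
        intro x
        rw [← hψh, ← specialLinear_mul_mulVec, mul_inv_cancel, Matrix.SpecialLinearGroup.coe_one,
          one_mulVec]
      have := specialLinear_inv_mulVec_mulVec h⁻¹ (x - (ψ ⬝ᵥ x) • w)
      rw [inv_inv] at this
      rw [specialLinear_mul_mulVec h, specialLinear_mul_mulVec (s * h⁻¹), specialLinear_mul_mulVec s, hs,
        rankOneTransvection_inv_mulVec, rankOneTransvection_mulVec, rankOneTransvection_mulVec,
        mulVec_add, mulVec_smul, h2, this, dotProduct_sub, dotProduct_smul, hψw, smul_zero,
        sub_zero, smul_sub]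
      abel
    have hk := H.mul_mem hhH (hH.conj_mem _ (H.inv_mem hhH) s)
    rw [hform] at hk
    exact ⟨_, _, _, sub_ne_zero.mpr hw, hψ0, hk⟩

theorem exists_specialLinear_mulVec {F : Type*} [Field F] {m : ℕ} (v w : Fin (m + 2) → F)
    (hv : v ≠ 0) (hw : w ≠ 0) : ∃ R : SpecialLinearGroup (Fin (m + 2)) F, R.1 *ᵥ w = v := by
  have h1 : ∀ x : Fin (m + 2) → F, x ≠ 0 →
      ∃ R : SpecialLinearGroup (Fin (m + 2)) F, R.1 *ᵥ Pi.single 0 1 = x := by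
    intro x hx
    obtain ⟨s, hs⟩ := exists_specialLinear_rows (by omega : 1 < m + 2) ![x]
      (by rw [linearIndependent_unique_iff]; simpa using hx)
    refine ⟨s.transpose, ?_⟩
    rw [mulVec_single_one]
    exact hs 0
  obtain ⟨R, hR⟩ := h1 v hv
  obtain ⟨T, hT⟩ := h1 w hw
  refine ⟨R * T⁻¹, ?_⟩
  rw [specialLinear_mul_mulVec, ← hT, specialLinear_inv_mulVec_mulVec, hR]

theorem columnTransvection_conj_of_ne_zero {F : Type*} [Field F] {m : ℕ} (hm : 1 ≤ m)
    (v w : Fin (m + 1) → F) (hv : v ≠ 0) (hw : w ≠ 0) :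
    ∃ r : SpecialLinearGroup (Fin (m + 2)) F,
      r⁻¹ * columnTransvection v * r = columnTransvection w := by
  obtain ⟨m, rfl⟩ : ∃ k, m = k + 1 := ⟨m - 1, by omega⟩
  obtain ⟨R, hR⟩ := exists_specialLinear_mulVec v w hv hw
  let B : Matrix (Fin (m + 1 + 2)) (Fin (m + 1 + 2)) F :=
    Matrix.of (Fin.cons (Pi.single 0 1) fun i => Fin.cons 0 (R.1 i))
  have hB : B.det = 1 := by
    rw [Matrix.det_succ_row_zero, Finset.sum_eq_single 0]
    · have : B.submatrix Fin.succ (Fin.succAbove 0) = R.1 := by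
        ext i j
        simp [B]
      rw [this, R.2]
      simp [B]
    · intro j _ hj
      simp [B, hj]
    · simp
  refine ⟨⟨B, hB⟩, specialLinear_conj_columnTransvection _ _ _ 1 ?_ ?_⟩
  · rw [single_one_vecMul, one_smul]
    rfl
  · rw [one_smul, ← hR]
    ext i
    refine Fin.cases ?_ (fun j => ?_) i
    · simp [B, mulVec]
    · simp [B, mulVec, dotProduct, Fin.sum_univ_succ]

theorem normal_eq_top_of_noncentral {F : Type*} [Field F] {m : ℕ} (hm : 1 ≤ m)
    (H : Subgroup (SpecialLinearGroup (Fin (m + 2)) F)) [hH : H.Normal]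
    (g : SpecialLinearGroup (Fin (m + 2)) F) (hgH : g ∈ H) (hg : g ∉ Subgroup.center _) :
    H = ⊤ := by
  obtain ⟨u, φ, h, hu, hφ, htH⟩ := exists_rankOneTransvection_mem_of_normal hm H g hgH hg
  obtain ⟨s, v, hsv⟩ := rankOneTransvection_eq_conj u φ h
  have hzero : columnTransvection (0 : Fin (m + 1) → F) = 1 := by
    have := columnTransvection_add (0 : Fin (m + 1) → F) 0
    rw [add_zero] at this
    exact (mul_eq_left.mp this.symm)
  have hvH : columnTransvection v ∈ H := by
    have : columnTransvection v = s⁻¹ * rankOneTransvection u φ h * s⁻¹⁻¹ := by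
      rw [hsv]; group
    rw [this]
    exact hH.conj_mem _ htH _
  have hv : v ≠ 0 := by
    rintro rfl
    rw [hzero, mul_one, mul_inv_cancel] at hsv
    obtain ⟨i, hi⟩ := Function.ne_iff.mp hφ
    have h1 := rankOneTransvection_mulVec u φ h (Pi.single i 1)
    rw [hsv, Matrix.SpecialLinearGroup.coe_one, one_mulVec, dotProduct_single_one] at h1
    exact (smul_ne_zero hi hu) (left_eq_add.mp h1)
  have hall : ∀ w : Fin (m + 1) → F, columnTransvection w ∈ H := by
    intro w
    by_cases hw : w = 0
    · rw [hw, hzero]; exact H.one_mem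
    · obtain ⟨r, hr⟩ := columnTransvection_conj_of_ne_zero hm v w hv hw
      rw [← hr]
      have := hH.conj_mem _ hvH r⁻¹
      rwa [inv_inv] at this
  rw [eq_top_iff]
  intro x _
  obtain ⟨l, -, hl, rfl⟩ := exists_transvections_prod x
  refine Subgroup.list_prod_mem H fun t ht => ?_
  obtain ⟨u', φ', h', rfl⟩ := hl t ht
  obtain ⟨s', w, hw⟩ := rankOneTransvection_eq_conj u' φ' h'
  rw [hw]
  exact hH.conj_mem _ (hall w) _

theorem projectiveSpecialLinear_normal_eq_top {F : Type*} [Field F] [Finite F] {m : ℕ}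
    (hF : ¬(m + 2 = 2 ∧ (Nat.card F = 2 ∨ Nat.card F = 3)))
    (H : Subgroup (ProjectiveSpecialLinearGroup (Fin (m + 2)) F)) (hH : H.Normal) (hne : H ≠ ⊥) :
    H = ⊤ := by
  rcases Nat.eq_zero_or_pos m with rfl | hm
  · have h4 : 4 ≤ Nat.card F := by
      have : 1 < Nat.card F := Finite.one_lt_card
      by_contra hlt
      exact hF ⟨rfl, by omega⟩
    have := Matrix.ProjectiveSpecialLinearGroup.rank_two_simple (F := F) h4
    exact (hH.eq_bot_or_eq_top).resolve_left hne
  · obtain ⟨⟨x, hx⟩, hx1⟩ := Subgroup.ne_bot_iff_exists_ne_one.mp hne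
    obtain ⟨g, rfl⟩ := QuotientGroup.mk_surjective x
    have htop := normal_eq_top_of_noncentral hm
      (H.comap (QuotientGroup.mk' (Subgroup.center (SpecialLinearGroup (Fin (m + 2)) F)))) g hx
      (fun h => hx1 (Subtype.ext ((QuotientGroup.eq_one_iff g).mpr h)))
    rw [eq_top_iff]
    intro y _
    obtain ⟨z, rfl⟩ := QuotientGroup.mk_surjective y
    have : z ∈ (⊤ : Subgroup (SpecialLinearGroup (Fin (m + 2)) F)) := Subgroup.mem_top z
    rw [← htop] at this
    exact this

theorem exists_conj_ne_projectiveSpecialLinear {F : Type*} [Field F] {m : ℕ}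
    (a : ProjectiveSpecialLinearGroup (Fin (m + 2)) F) (ha : a ≠ 1) : ∃ h, h * a * h⁻¹ ≠ a := by
  by_contra! hcomm
  obtain ⟨g, rfl⟩ := QuotientGroup.mk_surjective a
  have hg : g ∉ Subgroup.center (SpecialLinearGroup (Fin (m + 2)) F) :=
    fun h => ha ((QuotientGroup.eq_one_iff g).mpr h)
  obtain ⟨p, hp⟩ := exists_conjWord_krylovDet_ne_zero g
    (exists_linearIndependent_vecMul g⁻¹ (fun h => hg (by
      have := Subgroup.inv_mem _ h
      rwa [inv_inv] at this))) (m + 1) le_rfl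
  have hconj : ∀ h, g⁻¹ * (h * g * h⁻¹) ∈ Subgroup.center (SpecialLinearGroup (Fin (m + 2)) F) :=
    fun h => QuotientGroup.eq.mp (hcomm (h : SpecialLinearGroup (Fin (m + 2)) F)).symm
  have hmem : conjWord g p ∈ Subgroup.center (SpecialLinearGroup (Fin (m + 2)) F) := by
    refine Subgroup.list_prod_mem _ fun x hx => ?_
    obtain ⟨i, rfl⟩ := (List.mem_ofFn' _ _).mp hx
    have h1 := hconj (p i).1
    have h2 := Subgroup.inv_mem _ (hconj (p i).2)
    have h3 := Subgroup.mul_mem _ h1 h2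
    have h4 := (inferInstance : (Subgroup.center
      (SpecialLinearGroup (Fin (m + 2)) F)).Normal).conj_mem _ h3 g
    convert h4 using 1
    group
  obtain ⟨c, -, hc⟩ := Matrix.SpecialLinearGroup.mem_center_iff.mp hmem
  apply hp
  rw [krylovDet, ← hc]
  refine Matrix.det_eq_zero_of_row_eq_zero 1 fun j => ?_
  rw [of_apply, ← map_pow]
  simp [Matrix.scalar_apply, Matrix.diagonal]

theorem sum_indicator_sub_density {G : Type*} [Fintype G] [Nonempty G] [DecidableEq G]
    (B : Finset G) :
    ∑ x, ((if x ∈ B then (1 : ℝ) else 0) - B.card / Fintype.card G) = 0 := by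
  have : (Fintype.card G : ℝ) ≠ 0 := Nat.cast_ne_zero.mpr Fintype.card_ne_zero
  rw [Finset.sum_sub_distrib]
  simp only [Finset.sum_ite_mem, Finset.univ_inter, Finset.sum_const, nsmul_eq_mul, mul_one,
    Finset.card_univ]
  field_simp
  ring

theorem sum_sq_indicator_sub_density_le {G : Type*} [Fintype G] [Nonempty G] [DecidableEq G]
    (B : Finset G) :
    ∑ x, ((if x ∈ B then (1 : ℝ) else 0) - B.card / Fintype.card G) ^ 2 ≤ B.card := by
  have hn : (Fintype.card G : ℝ) ≠ 0 := Nat.cast_ne_zero.mpr Fintype.card_ne_zero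
  have h : ∀ x, ((if x ∈ B then (1 : ℝ) else 0) - B.card / Fintype.card G) ^ 2 =
      (if x ∈ B then (1 : ℝ) else 0) - (B.card / Fintype.card G) ^ 2 -
        2 * (B.card / Fintype.card G) *
          ((if x ∈ B then (1 : ℝ) else 0) - B.card / Fintype.card G) := by
    intro x
    split_ifs <;> ring
  simp only [h]
  rw [Finset.sum_sub_distrib, ← Finset.mul_sum, sum_indicator_sub_density, Finset.sum_sub_distrib]
  simp only [Finset.sum_ite_mem, Finset.univ_inter, Finset.sum_const, nsmul_eq_mul, mul_one,
    mul_zero, sub_zero]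
  have : (0 : ℝ) ≤ (Finset.univ : Finset G).card * ((B.card : ℝ) / Fintype.card G) ^ 2 := by
    positivity
  linarith

theorem sum_sq_indicator {G : Type*} [Fintype G] [DecidableEq G] (B : Finset G) :
    ∑ x, (if x ∈ B then (1 : ℝ) else 0) ^ 2 = B.card := by
  simp

theorem sq_card_le_of_notMem_mul {G : Type*} [Group G] [Fintype G] [DecidableEq G] (γ : G) (δ : ℝ)
    (hδ : ∀ f₁ f₂ : G → ℝ, (∀ h x, f₁ (h * x * h⁻¹) = f₁ x) → (∀ h x, f₂ (h * x * h⁻¹) = f₂ x) →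
      ∑ x, f₁ x = 0 → (∑ x, f₁ (γ * x) * f₂ x) ^ 2 ≤ δ * (∑ x, f₁ x ^ 2) * ∑ x, f₂ x ^ 2)
    (hδ0 : 0 ≤ δ) (A : Finset G) (hA : ∀ h a, h * a * h⁻¹ ∈ A ↔ a ∈ A) (hγ : γ ∉ A * A) :
    (A.card : ℝ) ^ 2 ≤ δ * (Fintype.card G : ℝ) ^ 2 := by
  have hn : 0 < (Fintype.card G : ℝ) := Nat.cast_pos.mpr Fintype.card_pos
  have hA' : ∀ h a, h * a * h⁻¹ ∈ A⁻¹ ↔ a ∈ A⁻¹ := by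
    intro h a
    rw [Finset.mem_inv', Finset.mem_inv', ← hA h a⁻¹]
    group
  have key := hδ (fun x => (if x ∈ A then (1 : ℝ) else 0) - A.card / Fintype.card G)
    (fun x => if x ∈ A⁻¹ then (1 : ℝ) else 0) (fun h x => by simp only [hA])
    (fun h x => by simp only [hA']) (sum_indicator_sub_density A)
  have hcorr : ∑ x, ((if γ * x ∈ A then (1 : ℝ) else 0) - A.card / Fintype.card G) *
      (if x ∈ A⁻¹ then (1 : ℝ) else 0) = -(A.card / Fintype.card G * A.card) := by
    have : ∀ x, ((if γ * x ∈ A then (1 : ℝ) else 0) - A.card / Fintype.card G) *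
        (if x ∈ A⁻¹ then (1 : ℝ) else 0) =
        -(A.card / Fintype.card G) * (if x ∈ A⁻¹ then (1 : ℝ) else 0) := by
      intro x
      by_cases hx : x ∈ A⁻¹
      · rw [if_neg, zero_sub]
        intro h
        refine hγ (Finset.mem_mul.mpr ⟨_, h, _, Finset.mem_inv'.mp hx, by group⟩)
      · simp [hx]
    simp only [this]
    rw [← Finset.mul_sum, Finset.sum_ite_mem, Finset.univ_inter, Finset.sum_const, nsmul_eq_mul,
      mul_one, Finset.card_inv, neg_mul]
  rw [hcorr, sum_sq_indicator, Finset.card_inv] at key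
  have h2 := key.trans (mul_le_mul_of_nonneg_right (mul_le_mul_of_nonneg_left
    (sum_sq_indicator_sub_density_le A) hδ0) (Nat.cast_nonneg _))
  rcases Nat.eq_zero_or_pos A.card with h0 | h0
  · rw [h0]
    simp only [Nat.cast_zero, ne_eq, OfNat.ofNat_ne_zero, not_false_eq_true, zero_pow]
    positivity
  · have hA0 : 0 < (A.card : ℝ) := Nat.cast_pos.mpr h0
    have h3 : (-((A.card : ℝ) / Fintype.card G * A.card)) ^ 2 =
        (A.card : ℝ) ^ 2 / (Fintype.card G : ℝ) ^ 2 * (A.card * A.card) := by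
      rw [neg_sq, mul_pow, div_pow]; ring
    rw [h3, mul_assoc] at h2
    have h4 := le_of_mul_le_mul_right h2 (by positivity)
    rwa [div_le_iff₀ (by positivity)] at h4

theorem card_le_card_mul_of_mem {G : Type*} [Group G] [Fintype G] [DecidableEq G] (g : G) (δ : ℝ)
    (hδ : ∀ f₁ f₂ : G → ℝ, (∀ h x, f₁ (h * x * h⁻¹) = f₁ x) → (∀ h x, f₂ (h * x * h⁻¹) = f₂ x) →
      ∑ x, f₁ x = 0 → (∑ x, f₁ (g * x) * f₂ x) ^ 2 ≤ δ * (∑ x, f₁ x ^ 2) * ∑ x, f₂ x ^ 2)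
    (hδ0 : 0 ≤ δ) (A : Finset G) (hA : ∀ h a, h * a * h⁻¹ ∈ A ↔ a ∈ A) (hg : g ∈ A)
    (hS : 2 * (A * A).card ≤ Fintype.card G) :
    (A.card : ℝ) ≤ 4 * δ * (A * A).card := by
  have hn : 0 < (Fintype.card G : ℝ) := Nat.cast_pos.mpr Fintype.card_pos
  have hA0 : 0 < (A.card : ℝ) := Nat.cast_pos.mpr (Finset.card_pos.mpr ⟨g, hg⟩)
  have hS1 : ∀ h a, a ∈ A * A → h * a * h⁻¹ ∈ A * A := by
    intro h a ha
    obtain ⟨b, hb, c, hc, rfl⟩ := Finset.mem_mul.mp ha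
    exact Finset.mem_mul.mpr ⟨_, (hA h b).mpr hb, _, (hA h c).mpr hc, by group⟩
  have hS' : ∀ h a, h * a * h⁻¹ ∈ A * A ↔ a ∈ A * A := by
    refine fun h a => ⟨fun ha => ?_, hS1 h a⟩
    have := hS1 h⁻¹ _ ha
    convert this using 1
    group
  have key := hδ (fun x => (if x ∈ A * A then (1 : ℝ) else 0) - (A * A).card / Fintype.card G)
    (fun x => if x ∈ A then (1 : ℝ) else 0) (fun h x => by simp only [hS'])
    (fun h x => by simp only [hA]) (sum_indicator_sub_density (A * A))
  have hcorr : ∑ x, ((if g * x ∈ A * A then (1 : ℝ) else 0) - (A * A).card / Fintype.card G) *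
      (if x ∈ A then (1 : ℝ) else 0) = (1 - (A * A).card / Fintype.card G) * A.card := by
    have : ∀ x, ((if g * x ∈ A * A then (1 : ℝ) else 0) - (A * A).card / Fintype.card G) *
        (if x ∈ A then (1 : ℝ) else 0) =
        (1 - (A * A).card / Fintype.card G) * (if x ∈ A then (1 : ℝ) else 0) := by
      intro x
      by_cases hx : x ∈ A
      · rw [if_pos (Finset.mul_mem_mul hg hx)]
      · simp [hx]
    simp only [this]
    rw [← Finset.mul_sum]
    simp
  rw [hcorr, sum_sq_indicator] at key
  have h2 := key.trans (mul_le_mul_of_nonneg_right (mul_le_mul_of_nonneg_left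
    (sum_sq_indicator_sub_density_le (A * A)) hδ0) (Nat.cast_nonneg _))
  have hσ : (1 : ℝ) / 2 ≤ 1 - (A * A).card / Fintype.card G := by
    have : (2 : ℝ) * (A * A).card ≤ Fintype.card G := by exact_mod_cast hS
    have : ((A * A).card : ℝ) / Fintype.card G ≤ 1 / 2 := by
      rw [div_le_iff₀ hn]; linarith
    linarith
  have hσ2 : (1 : ℝ) / 4 ≤ (1 - (A * A).card / Fintype.card G) ^ 2 := by nlinarith
  rw [mul_pow] at h2
  have h3 := (mul_le_mul_of_nonneg_right hσ2 (sq_nonneg (A.card : ℝ))).trans h2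
  have h4 : (1 / 4 * (A.card : ℝ)) * A.card ≤ (δ * (A * A).card) * A.card := by
    rw [sq] at h3; linarith
  have := le_of_mul_le_mul_right h4 hA0
  linarith

theorem card_le_of_correlation_bound {G : Type*} [Group G] [Fintype G] [DecidableEq G]
    (Z : Set G) (δ : ℝ) (hδ0 : 0 ≤ δ) (hδ1 : δ ≤ 1)
    (hδ : ∀ g ∉ Z, ∀ f₁ f₂ : G → ℝ, (∀ h x, f₁ (h * x * h⁻¹) = f₁ x) →
      (∀ h x, f₂ (h * x * h⁻¹) = f₂ x) →
      ∑ x, f₁ x = 0 → (∑ x, f₁ (g * x) * f₂ x) ^ 2 ≤ δ * (∑ x, f₁ x ^ 2) * ∑ x, f₂ x ^ 2)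
    (A : Finset G) (hA : ∀ h a, h * a * h⁻¹ ∈ A ↔ a ∈ A) (hAZ : ∃ a ∈ A, a ∉ Z)
    (hex : ∃ γ ∉ Z, γ ∉ A * A) : (A.card : ℝ) ≤ 4 * √δ * (A * A).card := by
  obtain ⟨a, ha, haZ⟩ := hAZ
  obtain ⟨γ, hγZ, hγ⟩ := hex
  have hδs : δ ≤ √δ := by
    refine Real.le_sqrt_of_sq_le ?_
    rw [sq]
    exact mul_le_of_le_one_left hδ0 hδ1
  by_cases hS : 2 * (A * A).card ≤ Fintype.card G
  · refine (card_le_card_mul_of_mem a δ (hδ a haZ) hδ0 A hA ha hS).trans ?_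
    gcongr
  · have h1 := sq_card_le_of_notMem_mul γ δ (hδ γ hγZ) hδ0 A hA hγ
    have h2 : (A.card : ℝ) ≤ √δ * Fintype.card G := by
      refine abs_le_of_sq_le_sq' ?_ (by positivity) |>.2
      rwa [mul_pow, Real.sq_sqrt hδ0]
    have h3 : (Fintype.card G : ℝ) ≤ 2 * (A * A).card := by exact_mod_cast (not_le.mp hS).le
    have h4 : (0 : ℝ) ≤ (A * A).card := Nat.cast_nonneg _
    have h5 := Real.sqrt_nonneg δ
    nlinarith [mul_le_mul_of_nonneg_left h3 h5, mul_nonneg h5 h4]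

/-- Correlation bounds for a finite group descend to a growth statement in central quotients. -/
theorem ncard_le_of_correlation_bound {G : Type*} [Group G] [Fintype G] [DecidableEq G]
    (Z : Subgroup G) [Z.Normal] (δ : ℝ) (hδ0 : 0 ≤ δ) (hδ1 : δ ≤ 1)
    (hδ : ∀ g ∉ Z, ∀ f₁ f₂ : G → ℝ, (∀ h x, f₁ (h * x * h⁻¹) = f₁ x) →
      (∀ h x, f₂ (h * x * h⁻¹) = f₂ x) →
      ∑ x, f₁ x = 0 → (∑ x, f₁ (g * x) * f₂ x) ^ 2 ≤ δ * (∑ x, f₁ x ^ 2) * ∑ x, f₂ x ^ 2)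
    (A : Set (G ⧸ Z)) (hA : ∀ a ∈ A, ∀ g, g * a * g⁻¹ ∈ A) (hA1 : ∃ a ∈ A, a ≠ 1)
    (hex : ∃ γ, γ ≠ 1 ∧ γ ∉ A * A) : (A.ncard : ℝ) ≤ 4 * √δ * (A * A).ncard := by
  classical
  set π : G → G ⧸ Z := QuotientGroup.mk with hπ
  have hcard : ∀ B : Set (G ⧸ Z), (Finset.univ.filter fun x => π x ∈ B).card =
      Nat.card Z * B.ncard := by
    intro B
    have h1 := Nat.card_congr (QuotientGroup.preimageMkEquivSubgroupProdSet Z B)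
    rw [Nat.card_prod, Nat.card_coe_set_eq, Nat.card_coe_set_eq] at h1
    rw [← h1, Set.ncard_eq_toFinset_card']
    congr 1
    ext x
    simp [hπ]
  set B := Finset.univ.filter fun x => π x ∈ A with hB
  have hmem : ∀ x, x ∈ B ↔ π x ∈ A := by simp [hB]
  have hBB : B * B = Finset.univ.filter fun x => π x ∈ A * A := by
    ext x
    rw [Finset.mem_mul, Finset.mem_filter, Set.mem_mul]
    constructor
    · rintro ⟨y, hy, z, hz, rfl⟩
      exact ⟨Finset.mem_univ _, _, (hmem y).mp hy, _, (hmem z).mp hz, rfl⟩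
    · rintro ⟨-, a, ha, b, hb, hab⟩
      obtain ⟨y, rfl⟩ := QuotientGroup.mk_surjective a
      refine ⟨y, (hmem y).mpr ha, y⁻¹ * x, (hmem _).mpr ?_, by group⟩
      have : π (y⁻¹ * x) = b := by
        change (π y)⁻¹ * π x = b
        rw [← hab]
        exact inv_mul_cancel_left _ _
      rwa [this]
  have hinv : ∀ h a, h * a * h⁻¹ ∈ B ↔ a ∈ B := by
    intro h a
    rw [hmem, hmem]
    refine ⟨fun ha => ?_, fun ha => hA _ ha (π h)⟩
    have h1 := hA _ ha (π h⁻¹)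
    have h2 : π h⁻¹ * π (h * a * h⁻¹) * (π h⁻¹)⁻¹ = π a := by
      change π (h⁻¹ * (h * a * h⁻¹) * h⁻¹⁻¹) = π a
      congr 1
      group
    rwa [h2] at h1
  have hne : ∀ x, π x ≠ 1 ↔ x ∉ (Z : Set G) := fun x =>
    not_congr (QuotientGroup.eq_one_iff x)
  have key := card_le_of_correlation_bound (Z : Set G) δ hδ0 hδ1 hδ B hinv
    (by
      obtain ⟨a, ha, ha1⟩ := hA1
      obtain ⟨y, rfl⟩ := QuotientGroup.mk_surjective a
      exact ⟨y, (hmem y).mpr ha, (hne y).mp ha1⟩)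
    (by
      obtain ⟨a, ha1, ha⟩ := hex
      obtain ⟨y, rfl⟩ := QuotientGroup.mk_surjective a
      exact ⟨y, (hne y).mp ha1, by rw [hBB]; simpa using ha⟩)
  have hcardBB : (B * B).card = Nat.card Z * (A * A).ncard := by
    rw [hBB, ← hcard]
    congr
  rw [hcardBB, hcard] at key
  have hZ : 0 < (Nat.card Z : ℝ) := Nat.cast_pos.mpr Nat.card_pos
  push_cast at key
  refine le_of_mul_le_mul_left ?_ hZ
  linarith

theorem exists_projectiveSpecialLinear_growth (m : ℕ) :
    ∃ κ : ℝ, 0 < κ ∧ ∃ q₀ : ℕ, ∀ (F : Type) [Field F] [Fintype F], q₀ ≤ Fintype.card F →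
      ∀ A : Set (ProjectiveSpecialLinearGroup (Fin (m + 2)) F),
        (∀ a ∈ A, ∀ g, g * a * g⁻¹ ∈ A) → (∃ a ∈ A, a ≠ 1) → (∃ γ, γ ≠ 1 ∧ γ ∉ A * A) →
        (A.ncard : ℝ) * (Fintype.card F : ℝ) ^ κ ≤ (A * A).ncard := by
  obtain ⟨C, hC, hbound⟩ := exists_specialLinear_correlation_bound m
  set N := 2 ^ (m + 1) with hN
  have hN0 : 0 < N := by positivity
  have hN0' : (0 : ℝ) < N := Nat.cast_pos.mpr hN0
  have hκ : (0 : ℝ) < 1 / (16 * N) := by positivity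
  have hlim := (tendsto_rpow_atTop hκ).comp (tendsto_natCast_atTop_atTop (R := ℝ))
  obtain ⟨q₁, hq₁⟩ := Filter.eventually_atTop.mp
    ((hlim.eventually_ge_atTop 4).and (hlim.eventually_ge_atTop C))
  refine ⟨1 / (16 * N), hκ, max q₁ (2 * (m + 2)), fun F _ _ hq A hA hA1 hex => ?_⟩
  classical
  obtain ⟨h4, hCt⟩ := hq₁ _ ((le_max_left _ _).trans hq)
  have hb := hbound F ((le_max_right _ _).trans hq)
  set q := Fintype.card F
  have hq0 : (0 : ℝ) ≤ q := Nat.cast_nonneg _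
  simp only [Function.comp_apply] at h4 hCt
  set t := (q : ℝ) ^ (1 / (16 * (N : ℝ))) with ht
  have ht0 : 0 < t := by linarith
  have hsqrt : √(q : ℝ) = t ^ (8 * N) := by
    rw [Real.sqrt_eq_rpow, ht, ← Real.rpow_natCast, ← Real.rpow_mul hq0]
    congr 1
    push_cast
    field_simp
    norm_num
  have hδN : C / √(q : ℝ) ≤ ((t ^ 4)⁻¹) ^ N := by
    rw [hsqrt, inv_pow, ← pow_mul, div_le_iff₀ (by positivity),
      (by ring : 8 * N = 4 * N + 4 * N), pow_add, inv_mul_cancel_left₀ (by positivity)]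
    exact hCt.trans (le_self_pow₀ (by linarith) (by omega))
  have key := ncard_le_of_correlation_bound
    (Subgroup.center (SpecialLinearGroup (Fin (m + 2)) F)) (t ^ 4)⁻¹ (by positivity)
    (inv_le_one_of_one_le₀ (one_le_pow₀ (by linarith))) (fun g hg f₁ f₂ hf₁ hf₂ hs => by
      have h1 := hb g hg f₁ f₂ hf₁ hf₂ hs
      have hS₁ : 0 ≤ ∑ x, f₁ x ^ 2 := Finset.sum_nonneg fun _ _ => sq_nonneg _
      have hS₂ : 0 ≤ ∑ x, f₂ x ^ 2 := Finset.sum_nonneg fun _ _ => sq_nonneg _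
      rw [← pow_le_pow_iff_left₀ (sq_nonneg _) (by positivity) hN0.ne', mul_pow, mul_pow]
      refine h1.trans ?_
      gcongr) A hA hA1 hex
  have hsδ : √((t ^ 4)⁻¹) = (t ^ 2)⁻¹ := by
    rw [Real.sqrt_inv, (by ring : t ^ 4 = (t ^ 2) ^ 2), Real.sqrt_sq (by positivity)]
  rw [hsδ] at key
  have h5 : (A.ncard : ℝ) * t ^ 2 ≤ 4 * (A * A).ncard := by
    have := mul_le_mul_of_nonneg_right key (by positivity : 0 ≤ t ^ 2)
    calc _ ≤ _ := this
      _ = _ := by field_simp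
  have h6 : (A.ncard : ℝ) * (4 * t) ≤ A.ncard * t ^ 2 := by
    refine mul_le_mul_of_nonneg_left ?_ (Nat.cast_nonneg _)
    nlinarith
  linarith

theorem ncard_lt_ncard_mul_or_eq_univ {G : Type*} [Group G] [Finite G]
    (hsimple : ∀ H : Subgroup G, H.Normal → H ≠ ⊥ → H = ⊤)
    (hcenter : ∀ a : G, a ≠ 1 → ∃ h, h * a * h⁻¹ ≠ a)
    (A : Set G) (hA : ∀ a ∈ A, ∀ g, g * a * g⁻¹ ∈ A) (hA1 : ∃ a ∈ A, a ≠ 1) :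
    A.ncard < (A * A).ncard ∨ A * A = Set.univ := by
  obtain ⟨a, ha, ha1⟩ := hA1
  by_cases hlt : A.ncard < (A * A).ncard
  · exact Or.inl hlt
  right
  have hsmul : ∀ b ∈ A, b • A = A * A := by
    intro b hb
    refine Set.eq_of_subset_of_ncard_le ?_ ?_ (Set.toFinite _)
    · rintro _ ⟨x, hx, rfl⟩
      exact Set.mul_mem_mul hb hx
    · rw [Set.ncard_smul_set]
      exact not_lt.mp hlt
  set H := MulAction.stabilizer G A with hH
  have hnormal : H.Normal := by
    refine ⟨fun n hn g => ?_⟩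
    have hn' : ∀ x ∈ A, n * x ∈ A := by
      intro x hx
      have : n • A = A := hn
      rw [← this]
      exact Set.smul_mem_smul_set hx
    rw [hH, MulAction.mem_stabilizer_iff]
    refine Set.eq_of_subset_of_ncard_le ?_ (by rw [Set.ncard_smul_set]) (Set.toFinite _)
    rintro _ ⟨x, hx, rfl⟩
    have := hA _ (hn' _ (hA x hx g⁻¹)) g
    convert this using 1
    simp only [smul_eq_mul]
    group
  obtain ⟨h, hh⟩ := hcenter a ha1
  have hmem : a⁻¹ * (h * a * h⁻¹) ∈ H := by
    rw [hH, MulAction.mem_stabilizer_iff, mul_smul, hsmul _ (hA a ha h), ← hsmul a ha,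
      inv_smul_smul]
  have htop := hsimple H hnormal fun hbot => by
    rw [hbot, Subgroup.mem_bot, inv_mul_eq_one] at hmem
    exact hh hmem.symm
  have huniv : A = Set.univ := by
    refine Set.eq_univ_of_forall fun x => ?_
    have h1 : x * a⁻¹ ∈ H := htop ▸ Subgroup.mem_top _
    have h2 : (x * a⁻¹) • A = A := h1
    rw [← h2]
    exact ⟨a, ha, by simp⟩
  rw [huniv, Set.univ_mul_univ]

theorem ncard_projectiveSpecialLinear_le {F : Type*} [Field F] [Fintype F] {n : ℕ}
    (A : Set (ProjectiveSpecialLinearGroup (Fin n) F)) :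
    A.ncard ≤ Fintype.card F ^ (n * n) := by
  classical
  calc A.ncard ≤ Nat.card (ProjectiveSpecialLinearGroup (Fin n) F) := by
        rw [← Set.ncard_univ]; exact Set.ncard_le_ncard (Set.subset_univ _) (Set.toFinite _)
    _ ≤ Nat.card (SpecialLinearGroup (Fin n) F) :=
        Nat.card_le_card_of_surjective _ QuotientGroup.mk_surjective
    _ ≤ Nat.card (Matrix (Fin n) (Fin n) F) :=
        Nat.card_le_card_of_injective Subtype.val Subtype.val_injective
    _ = Fintype.card F ^ (n * n) := by
        rw [Nat.card_congr Matrix.of.symm, Nat.card_fun, Nat.card_fun, Nat.card_eq_fintype_card,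
          Nat.card_eq_fintype_card, Fintype.card_fin, pow_mul]

/-- A power slightly larger than one increases integers up to `M` by at most one. -/
theorem rpow_one_add_le_add_one {M x : ℕ} {ε : ℝ} (hx : 1 ≤ x) (hxM : x ≤ M) (hε0 : 0 ≤ ε)
    (hε : ε ≤ Real.log (1 + 1 / M) / M) : (x : ℝ) ^ (1 + ε) ≤ x + 1 := by
  have hx0 : (0 : ℝ) < x := Nat.cast_pos.mpr hx
  have hxM' : (x : ℝ) ≤ M := Nat.cast_le.mpr hxM
  have hM0 : (0 : ℝ) < M := hx0.trans_le hxM'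
  rw [Real.rpow_add hx0, Real.rpow_one]
  have h1 : (x : ℝ) ^ ε ≤ 1 + 1 / M := by
    rw [Real.rpow_def_of_pos hx0, ← Real.le_log_iff_exp_le (by positivity)]
    have h2 : Real.log x ≤ M := ((Real.log_le_sub_one_of_pos hx0).trans (by linarith))
    calc Real.log x * ε ≤ M * ε := mul_le_mul_of_nonneg_right h2 hε0
      _ ≤ M * (Real.log (1 + 1 / M) / M) := mul_le_mul_of_nonneg_left hε hM0.le
      _ = _ := by field_simp
  calc (x : ℝ) * (x : ℝ) ^ ε ≤ x * (1 + 1 / M) := mul_le_mul_of_nonneg_left h1 hx0.le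
    _ = x + x / M := by ring
    _ ≤ x + 1 := by gcongr; exact (div_le_one hM0).mpr hxM'

end

theorem stmt11 (n : ℕ) (hn : 2 ≤ n) :
    ∃ ε : ℝ, 0 < ε ∧
      ∀ q : ℕ, IsPrimePow q → ¬(n = 2 ∧ (q = 2 ∨ q = 3)) →
      ∀ (F : Type) [Field F] [Fintype F], Fintype.card F = q →
      ∀ A : Set (Matrix.ProjectiveSpecialLinearGroup (Fin n) F),
        (∀ a ∈ A, ∀ g, g * a * g⁻¹ ∈ A) →
        (∃ a ∈ A, a ≠ 1) →
        ((A * A).ncard : ℝ) ≥ (A.ncard : ℝ) ^ ((1 : ℝ) + ε) ∨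
          ∀ g : Matrix.ProjectiveSpecialLinearGroup (Fin n) F, g ≠ 1 → g ∈ A * A := by
  obtain ⟨m, rfl⟩ : ∃ m, n = m + 2 := ⟨n - 2, by omega⟩
  obtain ⟨κ, hκ, q₀, hlarge⟩ := exists_projectiveSpecialLinear_growth m
  set d := (m + 2) * (m + 2) with hd
  have hd0 : (0 : ℝ) < d := by rw [hd]; positivity
  set M := (q₀ + 1) ^ d with hM
  have hM0 : (0 : ℝ) < M := by rw [hM]; positivity
  have hlog : 0 < Real.log (1 + 1 / M) / M :=
    div_pos (Real.log_pos (by have : (0 : ℝ) < 1 / M := by positivity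
                              linarith)) hM0
  refine ⟨min (κ / d) (Real.log (1 + 1 / M) / M), lt_min (by positivity) hlog, ?_⟩
  set ε := min (κ / d) (Real.log (1 + 1 / M) / M) with hε
  have hε0 : 0 ≤ ε := (lt_min (by positivity) hlog).le
  intro q _ hq F _ _ hFq A hA hA1
  subst hFq
  by_cases hall : ∀ g : Matrix.ProjectiveSpecialLinearGroup (Fin (m + 2)) F, g ≠ 1 → g ∈ A * A
  · exact Or.inr hall
  left
  have hA0 : 1 ≤ A.ncard := by
    obtain ⟨a, ha, -⟩ := hA1
    exact (Set.ncard_pos (Set.toFinite _)).mpr ⟨a, ha⟩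
  have hle := ncard_projectiveSpecialLinear_le A
  rw [← hd] at hle
  rcases le_or_gt q₀ (Fintype.card F) with hq₀ | hq₀
  · push Not at hall
    refine le_trans ?_ (hlarge F hq₀ A hA hA1 hall)
    have hx0 : (0 : ℝ) < A.ncard := Nat.cast_pos.mpr hA0
    rw [Real.rpow_add hx0, Real.rpow_one]
    refine mul_le_mul_of_nonneg_left ?_ hx0.le
    have hF1 : (1 : ℝ) ≤ Fintype.card F := Nat.one_le_cast.mpr Fintype.card_pos
    calc (A.ncard : ℝ) ^ ε ≤ ((Fintype.card F : ℝ) ^ d) ^ ε :=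
          Real.rpow_le_rpow hx0.le (by exact_mod_cast hle) hε0
      _ = (Fintype.card F : ℝ) ^ (d * ε) := by
          rw [← Real.rpow_natCast, ← Real.rpow_mul (by positivity)]
      _ ≤ (Fintype.card F : ℝ) ^ κ := by
          refine Real.rpow_le_rpow_of_exponent_le hF1 ?_
          have : ε ≤ κ / d := min_le_left _ _
          rw [le_div_iff₀ hd0] at this
          linarith
  · have hxM : A.ncard ≤ M :=
      hle.trans (Nat.pow_le_pow_left (by omega) _)
    refine (rpow_one_add_le_add_one hA0 hxM hε0 (min_le_right _ _)).trans ?_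
    rcases ncard_lt_ncard_mul_or_eq_univ
      (fun H hH hne => projectiveSpecialLinear_normal_eq_top
        (by rwa [Nat.card_eq_fintype_card]) H hH hne)
      exists_conj_ne_projectiveSpecialLinear A hA hA1 with h | h
    · exact_mod_cast h
    · exact absurd (fun g _ => h ▸ Set.mem_univ g) hall
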